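/- arXiv:1405.6560 — 5 statements merged into one kernel-verified Lean document; each statement's English description precedes it below -/
import Mathlib

section
/- Let Δ ≥ 2 be an integer and 0 < ε < 1/2. If c ≥ (30Δ/ε)·log(4e/ε), then the binomial random graph G(n, c/n) is almost surely T((1−ε)n, Δ)-universal. -/
/- Probability that the binomial random graph `G(n,p)` satisfies the property `P`. -/
open Classical in
noncomputable def probOf (n : ℕ) (p : ℝ) (P : SimpleGraph (Fin n) → Prop) : ℝ :=
  ∑ G : SimpleGraph (Fin n),
    if P G then p ^ G.edgeSet.ncard * (1 - p) ^ (n.choose 2 - G.edgeSet.ncard) else 0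

/-- `G` contains a copy of `T` (an injective graph homomorphism from `T` to `G`). -/
def ContainsCopy {V W : Type*} (T : SimpleGraph V) (G : SimpleGraph W) : Prop :=
  ∃ f : T →g G, Function.Injective f

/-- `G` is `T(M,Δ)`-universal: it contains a copy of every tree on at most `M` vertices
with maximum degree at most `Δ`. Here the bound `M = (1-ε)n` is a real number. -/
def TreeUniversal {W : Type*} (G : SimpleGraph W) (M : ℝ) (Δ : ℕ) : Prop :=
  ∀ m : ℕ, (m : ℝ) ≤ M → ∀ T : SimpleGraph (Fin m), T.IsTree →
    (∀ v, (T.neighborSet v).ncard ≤ Δ) → ContainsCopy T G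

open Finset

/-- The extension step of the Friedman–Pippenger argument: `r x` is the number of further
neighbours that may be requested at `x`, and `U` is the set of occupied vertices. -/
theorem exists_good_extension {V : Type*} [DecidableEq V] (N : V → Finset V) (Z U : Finset V)
    (m : ℕ) (hm : 1 ≤ m) (r : V → ℤ)
    (hgood : ∀ X : Finset V, Disjoint X Z → #X ≤ m → ∑ x ∈ X, r x ≤ #(X.biUnion N \ U))
    (hbig : ∀ X : Finset V, Disjoint X Z → m < #X → #X ≤ 2 * m →
      ∑ x ∈ X, r x < #(X.biUnion N \ U))
    (y : V) (hyZ : y ∉ Z) (hy : 1 ≤ r y) :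
    ∃ w ∈ N y \ U, ∀ X : Finset V, Disjoint X Z → #X ≤ m →
      ∑ x ∈ X, (r x - (if x = y then 1 else 0) - (if x = w then 1 else 0)) ≤
        #(X.biUnion N \ insert w U) := by
  by_contra! hno
  have key : ∀ s : Finset V, s ⊆ N y \ U → ∃ X : Finset V, Disjoint X Z ∧ #X ≤ m ∧ y ∉ X ∧
      s ⊆ X.biUnion N ∧ (#(X.biUnion N \ U) : ℤ) ≤ ∑ x ∈ X, r x := by
    intro s
    induction s using Finset.induction_on with
    | empty => exact fun _ => ⟨∅, by simp⟩
    | insert w s _ ih =>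
      intro hs
      obtain ⟨X, hXZ, hXm, hyX, hsX, hX⟩ := ih ((subset_insert _ _).trans hs)
      have hwU := hs (mem_insert_self w s)
      obtain ⟨Y, hYZ, hYm, hY⟩ := hno w hwU
      have hYgood := hgood Y hYZ hYm
      rw [sum_sub_distrib, sum_sub_distrib, sum_ite_eq', sum_ite_eq'] at hY
      have hsd : Y.biUnion N \ insert w U = (Y.biUnion N \ U).erase w := by
        ext a; simp only [mem_sdiff, mem_insert, mem_erase]; tauto
      rw [hsd] at hY
      have hwY : w ∈ Y.biUnion N \ U := by
        by_contra hcon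
        rw [erase_eq_of_notMem hcon] at hY
        split_ifs at hY <;> omega
      have hcard := card_erase_add_one hwY
      have hyY : y ∉ Y := by
        intro hcon
        rw [if_pos hcon] at hY
        split_ifs at hY <;> omega
      rw [if_neg hyY] at hY
      have hYcrit : (#(Y.biUnion N \ U) : ℤ) ≤ ∑ x ∈ Y, r x := by
        split_ifs at hY <;> omega
      have hsum := sum_union_inter (s₁ := X) (s₂ := Y) (f := r)
      have hinter := hgood (X ∩ Y) (hXZ.mono_left inter_subset_left)
        ((card_le_card inter_subset_left).trans hXm)
      have hunion : (X ∪ Y).biUnion N \ U = (X.biUnion N \ U) ∪ (Y.biUnion N \ U) := by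
        rw [union_biUnion, union_sdiff_distrib]
      have hintersub : (X ∩ Y).biUnion N \ U ⊆ (X.biUnion N \ U) ∩ (Y.biUnion N \ U) := by
        intro a
        simp only [mem_sdiff, mem_biUnion, mem_inter]
        rintro ⟨⟨b, ⟨hbX, hbY⟩, hab⟩, haU⟩
        exact ⟨⟨⟨b, hbX, hab⟩, haU⟩, ⟨b, hbY, hab⟩, haU⟩
      have hcu := card_union_add_card_inter (X.biUnion N \ U) (Y.biUnion N \ U)
      have hci := card_le_card hintersub
      rw [← hunion] at hcu
      have hcrit : (#((X ∪ Y).biUnion N \ U) : ℤ) ≤ ∑ x ∈ X ∪ Y, r x := by omega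
      have hdisj : Disjoint (X ∪ Y) Z := disjoint_union_left.2 ⟨hXZ, hYZ⟩
      have hle := card_union_le X Y
      refine ⟨X ∪ Y, hdisj, ?_, by simp [hyX, hyY], ?_, hcrit⟩
      · by_contra! hlt
        exact absurd (hbig _ hdisj hlt (by omega)) (not_lt.2 hcrit)
      · rw [union_biUnion]
        exact insert_subset (mem_union_right _ (mem_sdiff.1 hwY).1)
          (hsX.trans subset_union_left)
  obtain ⟨X, hXZ, hXm, hyX, hsX, hX⟩ := key _ Subset.rfl
  have hdisj : Disjoint (insert y X) Z := disjoint_insert_left.2 ⟨hyZ, hXZ⟩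
  have heq : (insert y X).biUnion N \ U = X.biUnion N \ U := by
    ext a
    simp only [biUnion_insert, mem_sdiff, mem_union]
    constructor
    · rintro ⟨h | h, hU⟩
      · exact ⟨hsX (mem_sdiff.2 ⟨h, hU⟩), hU⟩
      · exact ⟨h, hU⟩
    · exact fun h => ⟨Or.inr h.1, h.2⟩
  have hsum := sum_insert (f := r) hyX
  have hcard := card_insert_of_notMem hyX
  rcases Nat.lt_or_ge m #(insert y X) with h | h
  · have := hbig _ hdisj h (by omega)
    rw [heq] at this
    omega
  · have := hgood _ hdisj h
    rw [heq] at this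
    omega

/-- A tree embedding that can be extended greedily, together with its capacities `r`. -/
theorem exists_good_embedding {V : Type*} [Fintype V] [DecidableEq V] (G : SimpleGraph V)
    (N : V → Finset V) (hN : ∀ v, ∀ w ∈ N v, G.Adj v w) (Z : Finset V) (d m M : ℕ) (hm : 1 ≤ m)
    (hsmall : ∀ X : Finset V, Disjoint X Z → X.Nonempty → #X ≤ m →
      d * #X + 1 ≤ #(X.biUnion N \ Z))
    (hlarge : ∀ X : Finset V, Disjoint X Z → m < #X → #X ≤ 2 * m →
      d * #X + M ≤ #(X.biUnion N \ Z))
    (v₀ : V) (hv₀ : v₀ ∉ Z) (k : ℕ) :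
    ∀ (α : Type) [Fintype α] (T : SimpleGraph α), T.IsTree → Fintype.card α = k → k ≤ M →
      (∀ a, (T.neighborSet a).ncard ≤ d) →
      ∃ (f : α → V) (r : V → ℤ), Function.Injective f ∧ (∀ a b, T.Adj a b → G.Adj (f a) (f b)) ∧
        (∀ x, r x ≤ d) ∧ (∀ x, (∀ a, f a ≠ x) → r x = d) ∧
        (∀ a, (d : ℤ) ≤ r (f a) + (T.neighborSet a).ncard) ∧ (∀ a, f a ∉ Z) ∧
        ∀ X : Finset V, Disjoint X Z → #X ≤ m →
          ∑ x ∈ X, r x ≤ #(X.biUnion N \ (Z ∪ univ.image f)) := by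
  classical
  induction k with
  | zero =>
    intro α _ T hT hα
    have := hT.connected.nonempty
    exact absurd hα Fintype.card_ne_zero
  | succ k ih =>
    intro α _ T hT hα hkM hdeg
    have hne := hT.connected.nonempty
    rcases Nat.eq_zero_or_pos k with rfl | hk
    · have hsub : Subsingleton α := Fintype.card_le_one_iff_subsingleton.1 hα.le
      refine ⟨fun _ => v₀, fun _ => d, Function.injective_of_subsingleton _, ?_, fun _ => le_rfl,
        fun _ _ => rfl, fun _ => by simp, fun _ => hv₀, ?_⟩
      · intro a b hab
        exact absurd (Subsingleton.elim a b) hab.ne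
      · intro X hXZ hXm
        rcases X.eq_empty_or_nonempty with rfl | hX
        · simp
        · have h1 := hsmall X hXZ hX hXm
          have h2 : X.biUnion N \ (Z ∪ univ.image fun _ : α => v₀) =
              (X.biUnion N \ Z).erase v₀ := by
            ext a
            simp only [mem_sdiff, mem_union, mem_erase, mem_image, mem_univ, true_and,
              exists_const]
            grind
          have h3 := pred_card_le_card_erase (s := X.biUnion N \ Z) (a := v₀)
          rw [h2, sum_const, nsmul_eq_mul, mul_comm]
          have h4 : d * #X ≤ #((X.biUnion N \ Z).erase v₀) := by omega
          exact_mod_cast h4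
    · have hnt : Nontrivial α := Fintype.one_lt_card_iff_nontrivial.1 (by omega)
      obtain ⟨t, ht⟩ := hT.exists_vert_degree_one_of_nontrivial
      obtain ⟨s, hts, hs⟩ := SimpleGraph.degree_eq_one_iff_existsUnique_adj.1 ht
      have htree : (T.induce ({t}ᶜ : Set α)).IsTree :=
        ⟨hT.connected.induce_compl_singleton_of_degree_eq_one ht, hT.isAcyclic.induce _⟩
      have hst : s ∈ ({t}ᶜ : Set α) := by simpa using hts.ne'
      have himg : ∀ a : ({t}ᶜ : Set α), Set.image Subtype.val ((T.induce ({t}ᶜ : Set α)).neighborSet a)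
          ⊆ T.neighborSet a := by
        rintro a _ ⟨b, hb, rfl⟩
        exact hb
      have hle : ∀ a : ({t}ᶜ : Set α), ((T.induce ({t}ᶜ : Set α)).neighborSet a).ncard ≤
          (T.neighborSet a).ncard := by
        intro a
        rw [← Set.ncard_image_of_injective _ Subtype.val_injective]
        exact Set.ncard_le_ncard (himg a)
      have hlt : ((T.induce ({t}ᶜ : Set α)).neighborSet ⟨s, hst⟩).ncard + 1 ≤
          (T.neighborSet s).ncard := by
        rw [← Set.ncard_image_of_injective _ Subtype.val_injective]
        refine Set.ncard_lt_ncard ((himg ⟨s, hst⟩).ssubset_of_ne fun h => ?_)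
        have : t ∈ Set.image Subtype.val ((T.induce ({t}ᶜ : Set α)).neighborSet ⟨s, hst⟩) := by
          rw [h]; exact hts.symm
        obtain ⟨b, -, hb⟩ := this
        exact b.2 hb
      have hcard : Fintype.card ({t}ᶜ : Set α) = k := by
        have h := Set.ncard_add_ncard_compl ({t} : Set α)
        rw [Set.ncard_singleton, Nat.card_eq_fintype_card, hα] at h
        rw [← Nat.card_eq_fintype_card, Nat.card_coe_set_eq]
        omega
      obtain ⟨f, r, hinj, hadj, hrd, hr, hrdeg, hfZ, hgood⟩ := ih ({t}ᶜ : Set α)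
        (T.induce ({t}ᶜ : Set α)) htree hcard (by omega) (fun a => (hle a).trans (hdeg a))
      have hcardf : #(univ.image f) ≤ k := by
        refine card_image_le.trans ?_
        rw [card_univ, hcard]
      obtain ⟨w, hw, hwgood⟩ := exists_good_extension N Z (Z ∪ univ.image f) m hm r
        hgood (by
          intro X hXZ h1 h2
          have h3 := hlarge X hXZ h1 h2
          have h4 : ∑ x ∈ X, r x ≤ ((d * #X : ℕ) : ℤ) := by
            refine (sum_le_card_nsmul X r d fun x _ => hrd x).trans ?_
            rw [nsmul_eq_mul, mul_comm]; push_cast; rfl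
          have h5 : #(X.biUnion N \ Z) ≤
              #(X.biUnion N \ (Z ∪ univ.image f)) + #(univ.image f) := by
            have := le_card_sdiff (univ.image f) (X.biUnion N \ Z)
            rw [sdiff_sdiff_left] at this
            have h6 : Z ⊔ univ.image f = Z ∪ univ.image f := rfl
            rw [h6] at this
            omega
          omega) (f ⟨s, hst⟩) (hfZ _) (by
          have := hrdeg ⟨s, hst⟩
          have := hdeg s
          omega)
      rw [mem_sdiff, mem_union, not_or] at hw
      obtain ⟨hwN, hwZ, hwf⟩ := hw
      have hwf' : ∀ a, f a ≠ w := fun a h => hwf (mem_image.2 ⟨a, mem_univ _, h⟩)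
      have hws : w ≠ f ⟨s, hst⟩ := (hwf' _).symm
      have hnet : ∀ a, a ≠ t → a ∈ ({t}ᶜ : Set α) := fun a h => h
      let g : α → V := fun a => if h : a = t then w else f ⟨a, hnet a h⟩
      have hgt : g t = w := dif_pos rfl
      have hgf : ∀ a (h : a ≠ t), g a = f ⟨a, hnet a h⟩ := fun a h => dif_neg h
      have hsadj := hN _ _ hwN
      have hgimg : Z ∪ univ.image g = insert w (Z ∪ univ.image f) := by
        ext x
        simp only [mem_union, mem_image, mem_univ, true_and, mem_insert]
        constructor
        · rintro (h | ⟨a, rfl⟩)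
          · exact Or.inr (Or.inl h)
          · by_cases ha : a = t
            · exact Or.inl (ha ▸ hgt)
            · exact Or.inr (Or.inr ⟨⟨a, hnet a ha⟩, (hgf a ha).symm⟩)
        · rintro (rfl | h | ⟨a, rfl⟩)
          · exact Or.inr ⟨t, hgt⟩
          · exact Or.inl h
          · exact Or.inr ⟨a, hgf a a.2⟩
      let q : V → ℤ := fun x =>
        r x - (if x = f ⟨s, hst⟩ then 1 else 0) - (if x = w then 1 else 0)
      have hq : ∀ x, q x = r x - (if x = f ⟨s, hst⟩ then 1 else 0) - (if x = w then 1 else 0) :=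
        fun _ => rfl
      refine ⟨g, q, ?_, ?_, ?_, ?_, ?_, ?_, ?_⟩
      · intro a b hab
        by_cases ha : a = t <;> by_cases hb : b = t
        · rw [ha, hb]
        · rw [ha, hgt, hgf b hb] at hab
          exact absurd hab.symm (hwf' _)
        · rw [hb, hgt, hgf a ha] at hab
          exact absurd hab (hwf' _)
        · rw [hgf a ha, hgf b hb] at hab
          exact congrArg Subtype.val (hinj hab)
      · intro a b hab
        by_cases ha : a = t <;> by_cases hb : b = t
        · exact absurd (ha.trans hb.symm) hab.ne
        · subst ha
          obtain rfl := hs b hab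
          rw [hgt, hgf b hb]
          exact hsadj.symm
        · subst hb
          obtain rfl := hs a hab.symm
          rw [hgt, hgf a ha]
          exact hsadj
        · rw [hgf a ha, hgf b hb]
          exact hadj _ _ hab
      · intro x
        have := hrd x
        rw [hq]
        split_ifs <;> omega
      · intro x hx
        have h1 : x ≠ w := fun h => hx t (hgt.trans h.symm)
        have h2 : ∀ a, f a ≠ x := fun a h => hx a ((hgf a a.2).trans h)
        rw [hq, if_neg (h2 _).symm, if_neg h1, hr x h2]
        simp
      · intro a
        by_cases ha : a = t
        · have h1 : 1 ≤ (T.neighborSet a).ncard := by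
            rw [ha, Nat.one_le_iff_ne_zero, Nat.ne_zero_iff_zero_lt, Set.ncard_pos]
            exact ⟨s, hts⟩
          have h2 := hr w hwf'
          rw [ha] at h1 ⊢
          rw [hgt, hq, if_neg hws, if_pos rfl]
          omega
        · have h1 := hrdeg ⟨a, hnet a ha⟩
          have h2 := hle ⟨a, hnet a ha⟩
          rw [hgf a ha, hq, if_neg (hwf' _)]
          split_ifs with h
          · obtain rfl : a = s := congrArg Subtype.val (hinj h)
            omega
          · dsimp only at h2
            omega
      · intro a
        by_cases ha : a = t
        · rwa [ha, hgt]
        · rw [hgf a ha]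
          exact hfZ _
      · rw [hgimg]
        exact hwgood

/-- A graph with an edge between any two disjoint sets of sizes `m` and `k` contains all
bounded-degree trees on at most `M` vertices, provided `M` leaves enough room. -/
theorem treeUniversal_of_forall_exists_adj {V : Type*} [Fintype V] (G : SimpleGraph V)
    (Δ m k M : ℕ) (hm : 1 ≤ m) (hroom : k + 2 * m + 2 * m * Δ + M ≤ Fintype.card V)
    (hedge : ∀ A B : Finset V, Disjoint A B → #A = m → #B = k → ∃ a ∈ A, ∃ b ∈ B, G.Adj a b)
    (α : Type) [Fintype α] (T : SimpleGraph α) (hT : T.IsTree) (hα : Fintype.card α ≤ M)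
    (hdeg : ∀ a, (T.neighborSet a).ncard ≤ Δ) : ContainsCopy T G := by
  classical
  let N : V → Finset V := fun v => univ.filter (G.Adj v)
  have hN : ∀ v w, w ∈ N v ↔ G.Adj v w := fun v w => by simp [N]
  have hexp : ∀ X : Finset V, m ≤ #X → Fintype.card V ≤ #(X ∪ X.biUnion N) + k := by
    intro X hX
    obtain ⟨A, hAX, hA⟩ := exists_subset_card_eq hX
    have hsub : A ∪ A.biUnion N ⊆ X ∪ X.biUnion N :=
      union_subset_union hAX (biUnion_subset_biUnion_of_subset_left _ hAX)
    refine le_trans ?_ (Nat.add_le_add_right (card_le_card hsub) k)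
    by_contra! hlt
    have hc := card_add_card_compl (A ∪ A.biUnion N)
    obtain ⟨B, hB, hBk⟩ := exists_subset_card_eq (s := (A ∪ A.biUnion N)ᶜ) (n := k) (by omega)
    have hB' : ∀ b ∈ B, b ∉ A ∧ ∀ a ∈ A, ¬ G.Adj a b := by
      intro b hb
      have := hB hb
      simp only [mem_compl, mem_union, mem_biUnion, hN, not_or, not_exists, not_and] at this
      exact this
    obtain ⟨a, ha, b, hb, hab⟩ := hedge A B
      (disjoint_left.2 fun x hx hxB => (hB' x hxB).1 hx) hA hBk
    exact (hB' b hb).2 a ha hab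
  let bad : Finset (Finset V) :=
    univ.filter fun X => #X ≤ 2 * m ∧ #(X.biUnion N \ X) ≤ Δ * #X
  have hbadmem : ∀ X, X ∈ bad ↔ #X ≤ 2 * m ∧ #(X.biUnion N \ X) ≤ Δ * #X := fun X => by
    simp [bad]
  have hbadlt : ∀ X ∈ bad, #X < m := by
    intro X hX
    obtain ⟨h1, h2⟩ := (hbadmem X).1 hX
    by_contra! hmX
    have h3 := hexp X hmX
    have h4 : #(X ∪ X.biUnion N) = #X + #(X.biUnion N \ X) := by
      rw [← union_sdiff_self_eq_union, card_union_of_disjoint disjoint_sdiff]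
    have h5 : Δ * #X ≤ Δ * (2 * m) := Nat.mul_le_mul_left _ h1
    have h6 : Δ * (2 * m) = 2 * m * Δ := mul_comm _ _
    have : Nonempty α := hT.connected.nonempty
    have h7 : 0 < Fintype.card α := Fintype.card_pos
    omega
  obtain ⟨Z, hZ, hZmax⟩ := exists_max_image bad card ⟨∅, (hbadmem ∅).2 (by simp)⟩
  have hZm := hbadlt Z hZ
  have hZbad := ((hbadmem Z).1 hZ).2
  have hv : ∃ v, v ∉ Z := by
    by_contra! h
    have : #Z = Fintype.card V := by rw [eq_univ_of_forall h, card_univ]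
    omega
  obtain ⟨v, hv⟩ := hv
  obtain ⟨f, -, hinj, hadj, -⟩ := exists_good_embedding G N (fun v w h => (hN v w).1 h) Z Δ m M hm
    (by
      intro X hXZ hX hXm
      by_contra! hlt
      have hcard := card_union_of_disjoint hXZ
      have hXpos := hX.card_pos
      have hsub : (X ∪ Z).biUnion N \ (X ∪ Z) ⊆ (X.biUnion N \ Z) ∪ (Z.biUnion N \ Z) := by
        intro a
        simp only [union_biUnion, mem_sdiff, mem_union]
        tauto
      have hle := (card_le_card hsub).trans (card_union_le _ _)
      have hbad : X ∪ Z ∈ bad := by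
        refine (hbadmem _).2 ⟨by omega, ?_⟩
        rw [hcard, mul_add]
        omega
      have := hZmax _ hbad
      omega)
    (by
      intro X hXZ hmX hX
      obtain ⟨A, hAX, hA⟩ := exists_subset_card_eq hmX.le
      have h1 := hexp A hA.ge
      have h2 : A ∪ A.biUnion N ⊆ A ∪ Z ∪ (X.biUnion N \ Z) := by
        have := biUnion_subset_biUnion_of_subset_left N hAX
        intro a
        simp only [mem_union, mem_sdiff]
        intro h
        have := @this a
        tauto
      have h3 := (card_le_card h2).trans ((card_union_le _ _).trans
        (Nat.add_le_add_right (card_union_le _ _) _))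
      have h5 : Δ * #X ≤ Δ * (2 * m) := Nat.mul_le_mul_left _ hX
      have h6 : Δ * (2 * m) = 2 * m * Δ := mul_comm _ _
      omega)
    v hv (Fintype.card α) α T hT rfl hα hdeg
  exact ⟨⟨f, fun {a b} h => hadj a b h⟩, hinj⟩

theorem sum_simpleGraph_eq_sum_powerset {V : Type*} [Fintype V] [DecidableEq V]
    (φ : Set (Sym2 V) → ℝ) :
    ∑ G : SimpleGraph V, φ G.edgeSet =
      ∑ s ∈ ((⊤ : SimpleGraph V).edgeFinset).powerset, φ (s : Set (Sym2 V)) := by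
  classical
  refine sum_bij' (fun G _ => G.edgeFinset) (fun s _ => SimpleGraph.fromEdgeSet (s : Set (Sym2 V)))
    ?_ ?_ ?_ ?_ ?_
  · intro G _
    rw [mem_powerset]
    exact SimpleGraph.edgeFinset_mono le_top
  · simp
  · intro G _
    simp
  · intro s hs
    rw [mem_powerset] at hs
    ext e
    simp only [SimpleGraph.mem_edgeFinset, SimpleGraph.edgeSet_fromEdgeSet, Set.mem_sdiff, mem_coe]
    refine ⟨fun h => h.1, fun h => ⟨h, ?_⟩⟩
    have := hs h
    simpa using this
  · intro G _
    simp

open Classical in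
/-- A prescribed set `F` of pairs is avoided by `G(n,p)` with probability `(1-p)^|F|`. -/
theorem probOf_disjoint_edgeSet (n : ℕ) (p : ℝ) (F : Finset (Sym2 (Fin n)))
    (hF : F ⊆ (⊤ : SimpleGraph (Fin n)).edgeFinset) :
    probOf n p (fun G => Disjoint G.edgeSet F) = (1 - p) ^ #F := by
  unfold probOf
  rw [sum_simpleGraph_eq_sum_powerset (fun E : Set (Sym2 (Fin n)) => if Disjoint E F then
    p ^ E.ncard * (1 - p) ^ (n.choose 2 - E.ncard) else 0), ← sum_filter]
  have hfilter : ((⊤ : SimpleGraph (Fin n)).edgeFinset).powerset.filter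
      (fun s : Finset (Sym2 (Fin n)) => Disjoint (s : Set (Sym2 (Fin n))) F) =
      ((⊤ : SimpleGraph (Fin n)).edgeFinset \ F).powerset := by
    ext s
    rw [mem_filter, mem_powerset, mem_powerset, disjoint_coe, subset_sdiff]
  have htop : #(⊤ : SimpleGraph (Fin n)).edgeFinset = n.choose 2 := by
    simpa using SimpleGraph.card_edgeFinset_top_eq_card_choose_two (V := Fin n)
  have hcard := card_sdiff_add_card_eq_card hF
  have hsum := sum_pow_mul_eq_add_pow p (1 - p) ((⊤ : SimpleGraph (Fin n)).edgeFinset \ F)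
  rw [hfilter]
  calc _ = ∑ s ∈ ((⊤ : SimpleGraph (Fin n)).edgeFinset \ F).powerset, (1 - p) ^ #F *
        (p ^ #s * (1 - p) ^ (#((⊤ : SimpleGraph (Fin n)).edgeFinset \ F) - #s)) := by
        refine sum_congr rfl fun s hs => ?_
        have := card_le_card (mem_powerset.1 hs)
        rw [Set.ncard_coe_finset, mul_left_comm, ← pow_add]
        congr 2
        omega
    _ = (1 - p) ^ #F := by
        rw [← mul_sum, hsum, add_sub_cancel, one_pow, mul_one]

theorem probOf_true (n : ℕ) (p : ℝ) : probOf n p (fun _ => True) = 1 := by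
  simpa using probOf_disjoint_edgeSet n p ∅ (by simp)

theorem probOf_add_probOf_not (n : ℕ) (p : ℝ) (P : SimpleGraph (Fin n) → Prop) :
    probOf n p P + probOf n p (fun G => ¬ P G) = 1 := by
  rw [← probOf_true n p]
  unfold probOf
  rw [← sum_add_distrib]
  refine sum_congr rfl fun G _ => ?_
  by_cases h : P G <;> simp [h]

theorem probOf_nonneg (n : ℕ) (p : ℝ) (hp0 : 0 ≤ p) (hp1 : p ≤ 1)
    (P : SimpleGraph (Fin n) → Prop) : 0 ≤ probOf n p P := by
  have : 0 ≤ 1 - p := sub_nonneg.2 hp1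
  refine sum_nonneg fun G _ => ?_
  split_ifs <;> positivity

theorem probOf_le_sum {ι : Type*} (n : ℕ) (p : ℝ) (hp0 : 0 ≤ p) (hp1 : p ≤ 1) (s : Finset ι)
    (P : SimpleGraph (Fin n) → Prop) (Q : ι → SimpleGraph (Fin n) → Prop)
    (hPQ : ∀ G, P G → ∃ i ∈ s, Q i G) : probOf n p P ≤ ∑ i ∈ s, probOf n p (Q i) := by
  have hp : 0 ≤ 1 - p := sub_nonneg.2 hp1
  unfold probOf
  rw [sum_comm]
  refine sum_le_sum fun G _ => ?_
  have hnonneg : ∀ i ∈ s, 0 ≤ (@ite _ (Q i G) (Classical.propDecidable _)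
      (p ^ G.edgeSet.ncard * (1 - p) ^ (n.choose 2 - G.edgeSet.ncard)) 0) := by
    intro i _
    split_ifs <;> positivity
  split_ifs with h
  · obtain ⟨i, hi, hQ⟩ := hPQ G h
    refine le_trans ?_ (single_le_sum hnonneg hi)
    rw [if_pos hQ]
  · exact sum_nonneg hnonneg

/-- The union bound for the failure of the edge condition. -/
theorem probOf_exists_no_edge_le (n m k : ℕ) (p : ℝ) (hp0 : 0 ≤ p) (hp1 : p ≤ 1) :
    probOf n p (fun G => ¬ ∀ A B : Finset (Fin n), Disjoint A B → #A = m → #B = k →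
      ∃ a ∈ A, ∃ b ∈ B, G.Adj a b) ≤ n.choose m * n.choose k * (1 - p) ^ (m * k) := by
  let S := ((powersetCard m (univ : Finset (Fin n))) ×ˢ
    (powersetCard k (univ : Finset (Fin n)))).filter fun q => Disjoint q.1 q.2
  let F : Finset (Fin n) × Finset (Fin n) → Finset (Sym2 (Fin n)) := fun q =>
    (q.1 ×ˢ q.2).image fun x => s(x.1, x.2)
  have hS : ∀ q ∈ S, #q.1 = m ∧ #q.2 = k ∧ Disjoint q.1 q.2 := by
    intro q hq
    simp only [S, mem_filter, mem_product, mem_powersetCard_univ] at hq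
    exact ⟨hq.1.1, hq.1.2, hq.2⟩
  have hp : 0 ≤ 1 - p := sub_nonneg.2 hp1
  calc _ ≤ ∑ q ∈ S, probOf n p (fun G => Disjoint G.edgeSet (F q)) := by
        refine probOf_le_sum n p hp0 hp1 S _ _ fun G hG => ?_
        push Not at hG
        obtain ⟨A, B, hAB, hA, hB, hno⟩ := hG
        refine ⟨(A, B), by simp [S, hA, hB, hAB], ?_⟩
        rw [Set.disjoint_right]
        intro e he
        simp only [F, coe_image, Set.mem_image, mem_coe, mem_product] at he
        obtain ⟨⟨a, b⟩, ⟨ha, hb⟩, rfl⟩ := he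
        exact hno a ha b hb
    _ = ∑ q ∈ S, (1 - p) ^ (m * k) := by
        refine sum_congr rfl fun q hq => ?_
        obtain ⟨hm, hk, hd⟩ := hS q hq
        rw [probOf_disjoint_edgeSet]
        · congr 1
          rw [card_image_of_injOn, card_product, hm, hk]
          rintro ⟨a, b⟩ hab ⟨a', b'⟩ hab' h
          simp only [coe_product, Set.mem_prod, mem_coe] at hab hab'
          rw [Sym2.eq_iff] at h
          rcases h with ⟨rfl, rfl⟩ | ⟨rfl, rfl⟩
          · rfl
          · exact absurd hab'.2 (disjoint_left.1 hd hab.1)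
        · intro e he
          simp only [F, mem_image, mem_product] at he
          obtain ⟨⟨a, b⟩, ⟨ha, hb⟩, rfl⟩ := he
          simp only [SimpleGraph.mem_edgeFinset, SimpleGraph.mem_edgeSet, SimpleGraph.top_adj]
          exact fun hab => disjoint_left.1 hd ha (hab ▸ hb)
    _ ≤ _ := by
        rw [sum_const, nsmul_eq_mul]
        refine mul_le_mul_of_nonneg_right ?_ (pow_nonneg hp _)
        have h : #S ≤ n.choose m * n.choose k := by
          refine (card_filter_le _ _).trans ?_
          rw [card_product, card_powersetCard, card_powersetCard, card_univ, Fintype.card_fin]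
        exact_mod_cast h

theorem choose_le_exp (n k : ℕ) (x : ℝ) (hx : 0 < x) :
    (n.choose k : ℝ) ≤ Real.exp (x * n + k * Real.log x⁻¹) := by
  have h1 : (n.choose k : ℝ) * x ^ k ≤ Real.exp (x * n) := by
    rcases lt_or_ge n k with h | h
    · rw [Nat.choose_eq_zero_of_lt h, Nat.cast_zero, zero_mul]
      exact (Real.exp_pos _).le
    · calc (n.choose k : ℝ) * x ^ k = x ^ k * 1 ^ (n - k) * n.choose k := by
            rw [one_pow, mul_one, mul_comm]
        _ ≤ ∑ i ∈ range (n + 1), x ^ i * 1 ^ (n - i) * n.choose i :=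
            single_le_sum (f := fun i => x ^ i * 1 ^ (n - i) * (n.choose i : ℝ))
              (fun i _ => by positivity) (mem_range.2 (by omega))
        _ = (x + 1) ^ n := (add_pow x 1 n).symm
        _ ≤ Real.exp x ^ n := pow_le_pow_left₀ (by positivity) (Real.add_one_le_exp x) n
        _ = Real.exp (x * n) := by rw [← Real.exp_nat_mul, mul_comm]
  have hxk : 0 < x ^ k := pow_pos hx k
  rw [Real.exp_add, Real.exp_nat_mul, Real.exp_log (inv_pos.2 hx), inv_pow,
    ← div_eq_mul_inv, le_div_iff₀ hxk]
  exact h1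

/-- The quantitative form of the theorem, valid once `n` is large. -/
theorem probOf_not_treeUniversal_le (Δ : ℕ) (hΔ : 2 ≤ Δ) (ε : ℝ) (hε0 : 0 < ε) (hε1 : ε < 1 / 2)
    (c : ℝ) (hc : 30 * Δ / ε * Real.log (4 * Real.exp 1 / ε) ≤ c) (n : ℕ)
    (hn : 30 * Δ ≤ ε * n) (hcn : c ≤ n) :
    probOf n (c / n) (fun G => ¬ TreeUniversal G ((1 - ε) * n) Δ) ≤
      Real.exp (-(3 / 5 * ε * n)) := by
  set L := Real.log (4 * Real.exp 1 / ε) with hL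
  have hΔr : (2 : ℝ) ≤ Δ := by exact_mod_cast hΔ
  have hlog : Real.log (ε / 2)⁻¹ ≤ L - 1 := by
    have h : 4 * Real.exp 1 / ε = (ε / 2)⁻¹ * (2 * Real.exp 1) := by field_simp; norm_num
    rw [hL, h, Real.log_mul (by positivity) (by positivity),
      Real.log_mul (by positivity) (by positivity), Real.log_exp]
    linarith [Real.log_nonneg (show (1 : ℝ) ≤ 2 by norm_num)]
  have hlog0 : 0 ≤ Real.log (ε / 2)⁻¹ :=
    Real.log_nonneg ((one_le_inv₀ (by positivity)).2 (by linarith))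
  have hL1 : 1 ≤ L := by linarith
  have hn0 : (0 : ℝ) < n := pos_of_mul_pos_right (by linarith : 0 < ε * (n : ℝ)) hε0.le
  have hc0 : 0 < c := lt_of_lt_of_le (by positivity) hc
  set k := ⌊ε * n / 2⌋₊
  set m := ⌊ε * n / (6 * Δ)⌋₊
  set M := ⌊(1 - ε) * n⌋₊
  have hk : (k : ℝ) ≤ ε * n / 2 := Nat.floor_le (by positivity)
  have hm : (m : ℝ) ≤ ε * n / (6 * Δ) := Nat.floor_le (by positivity)
  have hM : (M : ℝ) ≤ (1 - ε) * n := Nat.floor_le (mul_nonneg (by linarith) hn0.le)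
  have hq : 5 ≤ ε * n / (6 * Δ) := by rw [le_div_iff₀ (by positivity)]; linarith
  have hk' : 4 / 5 * (ε * n / 2) ≤ k := by
    have := Nat.lt_floor_add_one (ε * n / 2)
    linarith
  have hm' : 4 / 5 * (ε * n / (6 * Δ)) ≤ m := by
    have := Nat.lt_floor_add_one (ε * n / (6 * Δ))
    linarith
  have hm1 : 1 ≤ m := by
    have : (1 : ℝ) ≤ m := by linarith
    exact_mod_cast this
  have hmΔ : (m : ℝ) * (6 * Δ) ≤ ε * n := (le_div_iff₀ (by positivity)).1 hm
  have hmΔ2 : (m : ℝ) * 2 ≤ m * Δ := mul_le_mul_of_nonneg_left hΔr (Nat.cast_nonneg m)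
  have hroom : k + 2 * m + 2 * m * Δ + M ≤ n := by
    have : (k : ℝ) + 2 * m + 2 * m * Δ + M ≤ n := by linarith
    exact_mod_cast this
  have hp0 : 0 ≤ c / n := by positivity
  have hp1 : c / n ≤ 1 := (div_le_one hn0).2 hcn
  have hmono : probOf n (c / n) (fun G => ¬ TreeUniversal G ((1 - ε) * n) Δ) ≤
      probOf n (c / n) (fun G => ¬ ∀ A B : Finset (Fin n), Disjoint A B → #A = m → #B = k →
        ∃ a ∈ A, ∃ b ∈ B, G.Adj a b) := by
    refine (probOf_le_sum n (c / n) hp0 hp1 {()} _ (fun _ G => ¬ ∀ A B : Finset (Fin n),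
      Disjoint A B → #A = m → #B = k → ∃ a ∈ A, ∃ b ∈ B, G.Adj a b) fun G hG =>
        ⟨(), mem_singleton_self _, fun hedge => hG ?_⟩).trans (sum_singleton _ _).le
    intro j hj T hT hdeg
    exact treeUniversal_of_forall_exists_adj G Δ m k M hm1 (by rwa [Fintype.card_fin]) hedge
      (Fin j) T hT (by rw [Fintype.card_fin]; exact Nat.le_floor hj) hdeg
  have hchoose : ∀ i : ℕ, (i : ℝ) ≤ ε * n / 2 →
      (n.choose i : ℝ) ≤ Real.exp (ε * n / 2 * L) := by
    intro i hi
    refine (choose_le_exp n i (ε / 2) (by positivity)).trans (Real.exp_le_exp.2 ?_)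
    have h1 : (i : ℝ) * Real.log (ε / 2)⁻¹ ≤ ε * n / 2 * (L - 1) :=
      mul_le_mul hi hlog hlog0 (by positivity)
    linarith
  have hpow : (1 - c / n) ^ (m * k) ≤ Real.exp (-(8 / 5 * (ε * n * L))) := by
    calc (1 - c / n) ^ (m * k) ≤ Real.exp (-(c / n)) ^ (m * k) :=
          pow_le_pow_left₀ (by linarith) (Real.one_sub_le_exp_neg _) _
      _ = Real.exp ((m * k : ℕ) * -(c / n)) := (Real.exp_nat_mul _ _).symm
      _ ≤ _ := by
        refine Real.exp_le_exp.2 ?_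
        have h1 : 4 / 5 * (ε * n / (6 * Δ)) * (4 / 5 * (ε * n / 2)) ≤ (m : ℝ) * k :=
          mul_le_mul hm' hk' (by positivity) (by positivity)
        have h2 : 30 * Δ / ε * L / n ≤ c / n := div_le_div_of_nonneg_right hc hn0.le
        have h3 := mul_le_mul h1 h2 (by positivity) (by positivity)
        have h4 : 4 / 5 * (ε * n / (6 * Δ)) * (4 / 5 * (ε * n / 2)) * (30 * Δ / ε * L / n) =
            8 / 5 * (ε * n * L) := by
          field_simp
          norm_num
        push_cast
        linarith
  have hmε : (m : ℝ) ≤ ε * n / 2 := by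
    linarith [Nat.cast_nonneg (α := ℝ) m]
  calc _ ≤ _ := hmono
    _ ≤ n.choose m * n.choose k * (1 - c / n) ^ (m * k) :=
        probOf_exists_no_edge_le n m k (c / n) hp0 hp1
    _ ≤ Real.exp (ε * n / 2 * L) * Real.exp (ε * n / 2 * L) *
        Real.exp (-(8 / 5 * (ε * n * L))) := by
        have h0 : 0 ≤ 1 - c / n := by linarith
        gcongr
        · exact hchoose m hmε
        · exact hchoose k hk
    _ ≤ Real.exp (-(3 / 5 * ε * n)) := by
        rw [← Real.exp_add, ← Real.exp_add]
        refine Real.exp_le_exp.2 ?_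
        have : ε * n * 1 ≤ ε * n * L := mul_le_mul_of_nonneg_left hL1 (by positivity)
        linarith

/-- For `Δ ≥ 2`, `0 < ε < 1/2` and `c ≥ (30Δ/ε)log(4e/ε)`, the random graph `G(n,c/n)`
is almost surely `T((1-ε)n,Δ)`-universal. -/
theorem stmt3 (Δ : ℕ) (hΔ : 2 ≤ Δ) (ε : ℝ) (hε0 : 0 < ε) (hε1 : ε < 1 / 2)
    (c : ℝ) (hc : 30 * Δ / ε * Real.log (4 * Real.exp 1 / ε) ≤ c) :
    Filter.Tendsto
      (fun n : ℕ => probOf n (c / n) (fun G => TreeUniversal G ((1 - ε) * n) Δ))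
      Filter.atTop (nhds 1) := by
  have hlim : Filter.Tendsto (fun n : ℕ => 1 - Real.exp (-(3 / 5 * ε * n))) Filter.atTop
      (nhds 1) := by
    have h1 : Filter.Tendsto (fun n : ℕ => 3 / 5 * ε * (n : ℝ)) Filter.atTop Filter.atTop :=
      tendsto_natCast_atTop_atTop.const_mul_atTop (by positivity)
    simpa using (Real.tendsto_exp_neg_atTop_nhds_zero.comp h1).const_sub 1
  have hc0 : 0 ≤ c := by
    refine le_trans (mul_nonneg (by positivity) (Real.log_nonneg ?_)) hc
    rw [le_div_iff₀ hε0]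
    linarith [Real.add_one_le_exp 1]
  have hlarge : ∀ᶠ n : ℕ in Filter.atTop, 30 * (Δ : ℝ) ≤ ε * n ∧ c ≤ n :=
    ((tendsto_natCast_atTop_atTop.const_mul_atTop hε0).eventually_ge_atTop _).and
      (tendsto_natCast_atTop_atTop.eventually_ge_atTop c)
  refine tendsto_of_tendsto_of_tendsto_of_le_of_le' hlim tendsto_const_nhds ?_ ?_
  · filter_upwards [hlarge] with n hn
    have h1 := probOf_add_probOf_not n (c / n) (fun G => TreeUniversal G ((1 - ε) * n) Δ)
    have h2 := probOf_not_treeUniversal_le Δ hΔ ε hε0 hε1 c hc n hn.1 hn.2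
    linarith
  · filter_upwards [hlarge] with n hn
    have h1 := probOf_add_probOf_not n (c / n) (fun G => TreeUniversal G ((1 - ε) * n) Δ)
    have h2 := probOf_nonneg n (c / n) (by positivity) (div_le_one_of_le₀ hn.2 (by positivity))
      (fun G => ¬ TreeUniversal G ((1 - ε) * n) Δ)
    linarith
end

section
/- Let 0 < ε < 1 and 0 ≤ β ≤ ε/7 be real numbers and let p = p(n) = (1+ε)log n / n. There exists a real number η = η(ε) with 0 < η < 1/2 such that for every U ⊆ [n] with |U| ≤ βn, almost surely the binomial random graph G = G(n,p) with V(G) = [n] satisfies: (1) the maximum degree Δ(G) ≤ 10 log n, and (2) every vertex u ∈ [n] has at least η log n neighbours in [n]\U. -/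
/-- The probability of the graph `G` under the binomial distribution `G(n,p)`. -/
noncomputable def graphWeight (n : ℕ) (p : ℝ) (G : SimpleGraph (Fin n)) : ℝ :=
  p ^ G.edgeSet.ncard * (1 - p) ^ (n.choose 2 - G.edgeSet.ncard)

lemma graphWeight_nonneg {n : ℕ} {p : ℝ} (hp0 : 0 ≤ p) (hp1 : p ≤ 1) (G : SimpleGraph (Fin n)) :
    0 ≤ graphWeight n p G :=
  mul_nonneg (pow_nonneg hp0 _) (pow_nonneg (sub_nonneg.2 hp1) _)

open Classical in
/-- The generating function of the number of edges of `G(n,p)` in a set `S` of pairs. -/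
lemma sum_graphWeight_mul_pow_edges (n : ℕ) (p t : ℝ) (S : Finset (Sym2 (Fin n)))
    (hS : ∀ e ∈ S, ¬ e.IsDiag) :
    ∑ G : SimpleGraph (Fin n), graphWeight n p G * t ^ (G.edgeSet ∩ ↑S).ncard =
      (1 - p + p * t) ^ S.card := by
  set E : Finset (Sym2 (Fin n)) := Finset.univ.filter (fun e => ¬ e.IsDiag) with hE
  have hcard : E.card = n.choose 2 := by
    have h := SimpleGraph.card_edgeFinset_top_eq_card_choose_two (V := Fin n)
    rw [Fintype.card_fin] at h
    rw [← h]
    congr 1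
    ext e
    simp [hE]
  have hSE : S ⊆ E := fun e he => by simp [hE, hS e he]
  have hprod : ∏ e ∈ E, (p * (if e ∈ S then t else 1) + (1 - p)) = (1 - p + p * t) ^ S.card := by
    rw [← Finset.prod_subset hSE, Finset.prod_congr rfl (g := fun _ => 1 - p + p * t),
      Finset.prod_const]
    · intro e he
      simp only [he, if_true]
      ring
    · intro e _ he
      simp [he]
  rw [← hprod, Finset.prod_add]
  refine Finset.sum_nbij' (fun G => G.edgeSet.toFinset)
    (fun T => SimpleGraph.fromEdgeSet (T : Set (Sym2 (Fin n)))) ?_ ?_ ?_ ?_ ?_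
  · intro G _
    rw [Finset.mem_powerset]
    intro e he
    simp only [hE, Finset.mem_filter, Finset.mem_univ, true_and]
    exact G.not_isDiag_of_mem_edgeSet (by simpa using he)
  · intro T _
    exact Finset.mem_univ _
  · intro G _
    simp
  · intro T hT
    ext e
    have : e ∈ T → ¬ e.IsDiag := fun h => by simpa [hE] using Finset.mem_powerset.1 hT h
    simp only [Set.mem_toFinset, SimpleGraph.edgeSet_fromEdgeSet, Set.mem_sdiff, Finset.mem_coe]
    exact ⟨fun h => h.1, fun h => ⟨h, this h⟩⟩
  · intro G _
    have hsub : G.edgeSet.toFinset ⊆ E := by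
      intro e he
      simp only [hE, Finset.mem_filter, Finset.mem_univ, true_and]
      exact G.not_isDiag_of_mem_edgeSet (by simpa using he)
    have h1 : (G.edgeSet ∩ ↑S).ncard = (G.edgeSet.toFinset.filter (· ∈ S)).card := by
      rw [← Set.ncard_coe_finset]
      congr 1
      ext e
      simp
    rw [graphWeight, Finset.prod_mul_distrib, Finset.prod_const, Finset.prod_const,
      Finset.card_sdiff_of_subset hsub, hcard, Set.ncard_eq_toFinset_card', h1,
      Finset.prod_ite, Finset.prod_const, Finset.prod_const_one, mul_one]
    ring

/-- The generating function of the number of neighbours of `u` in a set `W` not containing `u`. -/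
lemma sum_graphWeight_mul_pow_neighbors (n : ℕ) (p t : ℝ) (u : Fin n) (W : Finset (Fin n))
    (hu : u ∉ W) :
    ∑ G : SimpleGraph (Fin n), graphWeight n p G * t ^ (G.neighborSet u ∩ ↑W).ncard =
      (1 - p + p * t) ^ W.card := by
  have hinj : Function.Injective (fun w : Fin n => s(u, w)) := fun a b h =>
    Sym2.congr_right.1 h
  rw [← Finset.card_image_of_injective W hinj, ← sum_graphWeight_mul_pow_edges]
  · refine Finset.sum_congr rfl fun G _ => ?_
    congr 2
    rw [← Set.ncard_image_of_injective _ hinj]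
    congr 1
    ext e
    simp only [Set.mem_image, Set.mem_inter_iff, SimpleGraph.mem_neighborSet, Finset.mem_coe,
      Finset.mem_image]
    constructor
    · rintro ⟨w, ⟨h1, h2⟩, rfl⟩
      exact ⟨h1, w, h2, rfl⟩
    · rintro ⟨h1, w, h2, rfl⟩
      exact ⟨w, ⟨h1, h2⟩, rfl⟩
  · intro e he
    obtain ⟨w, hw, rfl⟩ := Finset.mem_image.1 he
    rw [Sym2.mk_isDiag_iff]
    rintro rfl
    exact hu hw

lemma sum_graphWeight (n : ℕ) (p : ℝ) : ∑ G : SimpleGraph (Fin n), graphWeight n p G = 1 := by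
  simpa using sum_graphWeight_mul_pow_edges n p 1 ∅ (by simp)

lemma probOf_le_one {n : ℕ} {p : ℝ} (hp0 : 0 ≤ p) (hp1 : p ≤ 1)
    (P : SimpleGraph (Fin n) → Prop) : probOf n p P ≤ 1 := by
  classical
  rw [← sum_graphWeight n p]
  refine Finset.sum_le_sum fun G _ => ?_
  split_ifs
  · exact le_rfl
  · exact graphWeight_nonneg hp0 hp1 G

/-- Markov's inequality for a nonnegative function that is at least one off `P`. -/
lemma one_sub_sum_le_probOf {n : ℕ} {p : ℝ} (hp0 : 0 ≤ p) (hp1 : p ≤ 1)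
    (P : SimpleGraph (Fin n) → Prop) (f : SimpleGraph (Fin n) → ℝ) (hf0 : ∀ G, 0 ≤ f G)
    (hf : ∀ G, ¬ P G → 1 ≤ f G) :
    1 - ∑ G, graphWeight n p G * f G ≤ probOf n p P := by
  classical
  rw [← sum_graphWeight n p, ← Finset.sum_sub_distrib]
  refine Finset.sum_le_sum fun G _ => ?_
  have hw := graphWeight_nonneg hp0 hp1 G
  split_ifs with h
  · exact sub_le_self _ (mul_nonneg hw (hf0 G))
  · nlinarith [hf G h]

/-- A Chernoff-type bound for the number of neighbours in a set, in exponential-moment form. -/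
lemma sum_graphWeight_mul_exp_le {n : ℕ} {p : ℝ} (hp0 : 0 ≤ p) (hp1 : p ≤ 1) (u : Fin n)
    (W : Finset (Fin n)) (hu : u ∉ W) (a c : ℝ) :
    ∑ G : SimpleGraph (Fin n),
        graphWeight n p G * Real.exp (a * ((G.neighborSet u ∩ ↑W).ncard - c)) ≤
      Real.exp (p * W.card * (Real.exp a - 1) - a * c) := by
  have h : ∀ G : SimpleGraph (Fin n),
      graphWeight n p G * Real.exp (a * ((G.neighborSet u ∩ ↑W).ncard - c)) =
      graphWeight n p G * Real.exp a ^ (G.neighborSet u ∩ ↑W).ncard * Real.exp (-(a * c)) := by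
    intro G
    rw [mul_assoc, ← Real.exp_nat_mul, ← Real.exp_add]
    ring_nf
  rw [Finset.sum_congr rfl fun G _ => h G, ← Finset.sum_mul,
    sum_graphWeight_mul_pow_neighbors n p _ u W hu,
    sub_eq_add_neg (p * _ * _), Real.exp_add]
  refine mul_le_mul_of_nonneg_right ?_ (Real.exp_pos _).le
  have h0 : 0 ≤ 1 - p + p * Real.exp a :=
    add_nonneg (sub_nonneg.2 hp1) (mul_nonneg hp0 (Real.exp_pos _).le)
  calc (1 - p + p * Real.exp a) ^ W.card ≤ Real.exp (p * (Real.exp a - 1)) ^ W.card := by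
        refine pow_le_pow_left₀ h0 ?_ _
        linarith [Real.add_one_le_exp (p * (Real.exp a - 1))]
    _ = Real.exp (p * W.card * (Real.exp a - 1)) := by
        rw [← Real.exp_nat_mul]
        ring_nf

/-- Quantitative form of the degree estimates; `a = log (8/ε)`. -/
lemma probOf_degrees_ge (ε β η a : ℝ) (hε0 : 0 < ε) (hε1 : ε < 1) (hβ : β ≤ ε / 7)
    (ha0 : 0 < a) (ha : Real.exp (-a) = ε / 8) (hη : a * η = ε / 12)
    (n : ℕ) (hn1 : 1 ≤ n) (hn : 14 ≤ ε * n)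
    (U : Finset (Fin n)) (hU : (U.card : ℝ) ≤ β * n)
    (hp0 : 0 ≤ (1 + ε) * Real.log n / n) (hp1 : (1 + ε) * Real.log n / n ≤ 1) :
    1 - (Real.exp (-Real.log n) + Real.exp (-(ε / 4) * Real.log n)) ≤
      probOf n ((1 + ε) * Real.log n / n) (fun G =>
        (∀ v, ((G.neighborSet v).ncard : ℝ) ≤ 10 * Real.log n) ∧
        (∀ u : Fin n, η * Real.log n ≤ ((G.neighborSet u \ ↑U).ncard : ℝ))) := by
  classical
  set L := Real.log n with hL
  set p := (1 + ε) * L / n with hp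
  have hnpos : (0 : ℝ) < n := by exact_mod_cast hn1
  have hL0 : 0 ≤ L := Real.log_natCast_nonneg n
  have hpn : p * n = (1 + ε) * L := by rw [hp]; field_simp
  let A : Fin n → Finset (Fin n) := fun u => Finset.univ.erase u
  let B : Fin n → Finset (Fin n) := fun u => Finset.univ \ insert u U
  have hA : ∀ (G : SimpleGraph (Fin n)) u, G.neighborSet u ∩ ↑(A u) = G.neighborSet u := by
    intro G u
    ext w
    simp only [A, Set.mem_inter_iff, SimpleGraph.mem_neighborSet, Finset.coe_erase,
      Finset.coe_univ, Set.mem_sdiff, Set.mem_univ, Set.mem_singleton_iff, true_and]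
    exact ⟨fun h => h.1, fun h => ⟨h, h.ne'⟩⟩
  have hB : ∀ (G : SimpleGraph (Fin n)) u, G.neighborSet u ∩ ↑(B u) = G.neighborSet u \ ↑U := by
    intro G u
    ext w
    simp only [B, Set.mem_inter_iff, SimpleGraph.mem_neighborSet, Finset.mem_coe,
      Finset.mem_sdiff, Finset.mem_univ, Finset.mem_insert, true_and, Set.mem_sdiff, not_or]
    exact ⟨fun h => ⟨h.1, h.2.2⟩, fun h => ⟨h.1, h.1.ne', h.2⟩⟩
  let f : SimpleGraph (Fin n) → ℝ := fun G =>
    ∑ u, Real.exp (1 * ((G.neighborSet u ∩ ↑(A u)).ncard - 10 * L)) +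
      ∑ u, Real.exp (-a * ((G.neighborSet u ∩ ↑(B u)).ncard - η * L))
  have hf0 : ∀ G, 0 ≤ f G := fun G => by positivity
  refine le_trans ?_ (one_sub_sum_le_probOf hp0 hp1 _ f hf0 ?_)
  · refine sub_le_sub_left ?_ _
    have hexp : ∀ x y : ℝ, L + x ≤ y → (n : ℝ) * Real.exp x ≤ Real.exp y := by
      intro x y hxy
      calc (n : ℝ) * Real.exp x = Real.exp (L + x) := by
            rw [Real.exp_add, hL, Real.exp_log hnpos]
        _ ≤ Real.exp y := Real.exp_le_exp.2 hxy
    have hupper : ∀ u : Fin n, ∑ G : SimpleGraph (Fin n), graphWeight n p G *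
        Real.exp (1 * ((G.neighborSet u ∩ ↑(A u)).ncard - 10 * L)) ≤
        Real.exp (-2 * L) := by
      intro u
      refine (sum_graphWeight_mul_exp_le hp0 hp1 u (A u) (by simp [A]) 1 _).trans
        (Real.exp_le_exp.2 ?_)
      have hcard : ((A u).card : ℝ) ≤ n := by
        exact_mod_cast (Finset.card_le_univ (A u)).trans_eq (Fintype.card_fin n)
      have h1 : p * (A u).card ≤ (1 + ε) * L := hpn ▸ mul_le_mul_of_nonneg_left hcard hp0
      have h2 : p * (A u).card ≤ 2 * L := h1.trans (by nlinarith)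
      have h3 : 0 ≤ p * (A u).card := by positivity
      nlinarith [Real.exp_one_lt_d9]
    have hlower : ∀ u : Fin n, ∑ G : SimpleGraph (Fin n), graphWeight n p G *
        Real.exp (-a * ((G.neighborSet u ∩ ↑(B u)).ncard - η * L)) ≤
        Real.exp (-(1 + ε / 4) * L) := by
      intro u
      refine (sum_graphWeight_mul_exp_le hp0 hp1 u (B u) (by simp [B]) (-a) _).trans
        (Real.exp_le_exp.2 ?_)
      have hcard : (1 - 3 * ε / 14) * n ≤ ((B u).card : ℝ) := by
        have h1 : n ≤ (B u).card + (U.card + 1) := by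
          have h2 := Finset.le_card_sdiff (insert u U) Finset.univ
          have h3 := Finset.card_insert_le u U
          rw [Finset.card_univ, Fintype.card_fin] at h2
          simp only [B]
          omega
        have h4 : (n : ℝ) ≤ (B u).card + (U.card + 1) := by exact_mod_cast h1
        nlinarith
      have h1 : (1 - 3 * ε / 14) * ((1 + ε) * L) ≤ p * (B u).card := by
        rw [← hpn]
        nlinarith [mul_le_mul_of_nonneg_left hcard hp0]
      have h2 : (1 + 4 * ε / 7) * L ≤ p * (B u).card := by
        refine le_trans ?_ h1
        rw [← mul_assoc]
        refine mul_le_mul_of_nonneg_right ?_ hL0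
        nlinarith
      have h3 : (1 + ε / 3) * L ≤ p * (B u).card * (1 - ε / 8) := by
        refine le_trans ?_ (mul_le_mul_of_nonneg_right h2 (by linarith))
        rw [mul_right_comm]
        refine mul_le_mul_of_nonneg_right ?_ hL0
        nlinarith
      have h4 : a * (η * L) = ε / 12 * L := by rw [← mul_assoc, hη]
      rw [ha]
      linarith
    calc ∑ G, graphWeight n p G * f G
        = ∑ u, ∑ G : SimpleGraph (Fin n), graphWeight n p G *
            Real.exp (1 * ((G.neighborSet u ∩ ↑(A u)).ncard - 10 * L)) +
          ∑ u, ∑ G : SimpleGraph (Fin n), graphWeight n p G *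
            Real.exp (-a * ((G.neighborSet u ∩ ↑(B u)).ncard - η * L)) := by
          simp only [f, mul_add, Finset.sum_add_distrib, Finset.mul_sum]
          congr 1 <;> exact Finset.sum_comm
      _ ≤ ∑ _u : Fin n, Real.exp (-2 * L) + ∑ _u : Fin n, Real.exp (-(1 + ε / 4) * L) :=
          add_le_add (Finset.sum_le_sum fun u _ => hupper u)
            (Finset.sum_le_sum fun u _ => hlower u)
      _ = n * Real.exp (-2 * L) + n * Real.exp (-(1 + ε / 4) * L) := by simp
      _ ≤ Real.exp (-L) + Real.exp (-(ε / 4) * L) :=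
          add_le_add (hexp _ _ (by linarith)) (hexp _ _ (by linarith))
  · intro G hG
    rw [not_and_or, not_forall, not_forall] at hG
    rcases hG with ⟨u, hu⟩ | ⟨u, hu⟩
    · refine le_trans ?_ (le_add_of_nonneg_right (by positivity))
      refine le_trans ?_ (Finset.single_le_sum (fun v _ => (Real.exp_pos _).le)
        (Finset.mem_univ u))
      rw [hA]
      exact Real.one_le_exp (by linarith)
    · refine le_trans ?_ (le_add_of_nonneg_left (by positivity))
      refine le_trans ?_ (Finset.single_le_sum (fun v _ => (Real.exp_pos _).le)
        (Finset.mem_univ u))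
      rw [hB]
      exact Real.one_le_exp (by nlinarith)

/-- For `0 < ε < 1`, `0 ≤ β ≤ ε/7` and `p = (1+ε)log n/n`, there is `0 < η < 1/2` such
that for any sets `U = U(n) ⊆ [n]` with `|U| ≤ βn`, almost surely `G(n,p)` has maximum
degree at most `10 log n` and every vertex has at least `η log n` neighbours outside `U`. -/
theorem stmt6 (ε β : ℝ) (hε0 : 0 < ε) (hε1 : ε < 1) (hβ0 : 0 ≤ β) (hβ : β ≤ ε / 7) :
    ∃ η : ℝ, 0 < η ∧ η < 1 / 2 ∧
      ∀ U : (n : ℕ) → Finset (Fin n), (∀ n : ℕ, ((U n).card : ℝ) ≤ β * n) →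
        Filter.Tendsto
          (fun n : ℕ => probOf n ((1 + ε) * Real.log n / n) (fun G =>
            (∀ v, ((G.neighborSet v).ncard : ℝ) ≤ 10 * Real.log n) ∧
            (∀ u : Fin n, η * Real.log n ≤ ((G.neighborSet u \ ↑(U n)).ncard : ℝ))))
          Filter.atTop (nhds 1) := by
  set a := Real.log (8 / ε) with ha
  have h8 : 0 < 8 / ε := by positivity
  have ha1 : 7 / 8 ≤ a := by
    have h := Real.one_sub_inv_le_log_of_pos h8
    rw [inv_div] at h
    linarith
  have ha0 : 0 < a := by linarith
  have hexp : Real.exp (-a) = ε / 8 := by rw [Real.exp_neg, ha, Real.exp_log h8, inv_div]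
  refine ⟨ε / 12 / a, by positivity, ?_, fun U hU => ?_⟩
  · rw [div_lt_iff₀ ha0]
    linarith
  have hlog : Filter.Tendsto (fun n : ℕ => Real.log n) Filter.atTop Filter.atTop :=
    Real.tendsto_log_atTop.comp tendsto_natCast_atTop_atTop
  have hdecay : ∀ c : ℝ, 0 < c → Filter.Tendsto (fun n : ℕ => Real.exp (-c * Real.log n))
      Filter.atTop (nhds 0) := fun c hc =>
    Real.tendsto_exp_atBot.comp (hlog.const_mul_atTop_of_neg (neg_lt_zero.2 hc))
  have hlim : Filter.Tendsto (fun n : ℕ =>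
      1 - (Real.exp (-Real.log n) + Real.exp (-(ε / 4) * Real.log n))) Filter.atTop (nhds 1) := by
    have h := ((hdecay 1 one_pos).add (hdecay (ε / 4) (by positivity))).const_sub 1
    simpa using h
  have hp : ∀ n : ℕ, 1 ≤ n → 0 ≤ (1 + ε) * Real.log n / n ∧ (1 + ε) * Real.log n / n ≤ 1 := by
    intro n hn
    have hn0 : (0 : ℝ) < n := by exact_mod_cast hn
    have hL0 := Real.log_natCast_nonneg n
    have hL : Real.log n ≤ n / 2 := by
      have h1 := Real.log_le_sub_one_of_pos (half_pos hn0)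
      rw [Real.log_div hn0.ne' two_ne_zero] at h1
      linarith [Real.log_two_lt_d9]
    refine ⟨by positivity, ?_⟩
    rw [div_le_one hn0]
    nlinarith
  refine tendsto_of_tendsto_of_tendsto_of_le_of_le' hlim tendsto_const_nhds ?_ ?_
  · filter_upwards [Filter.eventually_ge_atTop 1,
      tendsto_natCast_atTop_atTop.eventually_ge_atTop (14 / ε)] with n hn1 hn
    refine probOf_degrees_ge ε β _ a hε0 hε1 hβ ha0 hexp (by field_simp) n hn1 ?_ (U n) (hU n)
      (hp n hn1).1 (hp n hn1).2
    rwa [div_le_iff₀' hε0] at hn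
  · filter_upwards [Filter.eventually_ge_atTop 1] with n hn1
    exact probOf_le_one (hp n hn1).1 (hp n hn1).2 _
end

section
/- Let G be a graph on n vertices with maximum degree Δ. Let Y ⊆ V(G) be a set of m = a + b vertices, where a and b are positive integers. Assume d_G(v,Y) ≥ δ for every v ∈ V(G). If Δ²·⌈m/min{a,b}⌉·2·e^{1 − (min{a,b}²/(5m²))·δ} < 1, then there is a partition Y = A ∪ B with |A| = a, |B| = b, such that d_G(v,A) ≥ (a/3m)·d_G(v,Y) and d_G(v,B) ≥ (b/3m)·d_G(v,Y) for every v ∈ V(G). -/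
open MeasureTheory ProbabilityTheory Finset

/-- `1 / e ≤ (1 - 1 / D) ^ (D - 1)`. -/
theorem exp_neg_one_le_one_sub_inv_pow {D : ℕ} (hD : 2 ≤ D) :
    Real.exp (-1) ≤ (1 - (D : ℝ)⁻¹) ^ (D - 1) := by
  obtain ⟨n, rfl⟩ : ∃ n, D = n + 1 := ⟨D - 1, by omega⟩
  have hn : (0 : ℝ) < n := by exact_mod_cast (by omega : 0 < n)
  have h1 : 1 - ((n + 1 : ℕ) : ℝ)⁻¹ = (1 + (n : ℝ)⁻¹)⁻¹ := by
    push_cast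
    field_simp
    ring
  have h2 : (1 + (n : ℝ)⁻¹) ^ n ≤ Real.exp 1 := by
    calc (1 + (n : ℝ)⁻¹) ^ n ≤ Real.exp ((n : ℝ)⁻¹) ^ n := by
          gcongr
          linarith [Real.add_one_le_exp ((n : ℝ)⁻¹)]
      _ = Real.exp 1 := by
          rw [← Real.exp_nat_mul, mul_inv_cancel₀ hn.ne']
  rw [h1, Nat.add_sub_cancel, inv_pow, Real.exp_neg]
  gcongr

/-- The symmetric Lovász local lemma; `Γ v` is a closed dependency neighbourhood of `v`. -/
theorem lovasz_local_lemma_symmetric {Ω V : Type*} [MeasurableSpace Ω] [DecidableEq V]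
    (μ : Measure Ω) [IsProbabilityMeasure μ] (E : V → Set Ω) (hE : ∀ v, MeasurableSet (E v))
    (Γ : V → Finset V) (hΓ : ∀ v, v ∈ Γ v) {D : ℕ} (hD : 2 ≤ D) (hcard : ∀ v, #(Γ v) ≤ D)
    {p : ℝ} (hp : ∀ v, μ.real (E v) ≤ p) (hpD : Real.exp 1 * p * D ≤ 1)
    (hind : ∀ v (S : Finset V), Disjoint S (Γ v) →
      μ.real (E v ∩ ⋂ u ∈ S, (E u)ᶜ) = μ.real (E v) * μ.real (⋂ u ∈ S, (E u)ᶜ))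
    (S : Finset V) : 0 < μ.real (⋂ u ∈ S, (E u)ᶜ) := by
  set Q : Finset V → ℝ := fun S ↦ μ.real (⋂ u ∈ S, (E u)ᶜ) with hQ
  set x : ℝ := (D : ℝ)⁻¹ with hx
  have hD' : (2 : ℝ) ≤ D := by exact_mod_cast hD
  have hx0 : 0 < x := by positivity
  have hx1 : 0 < 1 - x := by
    have : x ≤ 2⁻¹ := by rw [hx]; gcongr
    linarith
  have hsplit (v : V) (S : Finset V) :
      Q (insert v S) = Q S - μ.real (E v ∩ ⋂ u ∈ S, (E u)ᶜ) := by
    have := measureReal_inter_add_sdiff (μ := μ) (s := ⋂ u ∈ S, (E u)ᶜ) (hE v)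
    have h : (⋂ u ∈ insert v S, (E u)ᶜ) = (⋂ u ∈ S, (E u)ᶜ) \ E v := by
      rw [Finset.set_biInter_insert, Set.inter_comm, Set.sdiff_eq]
    simp only [hQ]
    rw [h, Set.inter_comm (E v)]
    linarith
  have key (n : ℕ) : ∀ S : Finset V, #S = n → ∀ v, v ∉ S →
      μ.real (E v ∩ ⋂ u ∈ S, (E u)ᶜ) ≤ x * Q S := by
    induction n using Nat.strong_induction_on with
    | _ n ih =>
    rintro S rfl v hv
    have hsub (R : Finset V) : R ⊆ S ∩ Γ v →
        (1 - x) ^ #R * Q (S \ Γ v) ≤ Q (S \ Γ v ∪ R) := by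
      induction R using Finset.induction_on with
      | empty => simp
      | insert w R hw ihR =>
        intro hR
        have hwS := hR (mem_insert_self w R)
        have hRS : R ⊆ S ∩ Γ v := (subset_insert _ _).trans hR
        have hwn : w ∉ S \ Γ v ∪ R := by
          simp only [mem_union, mem_sdiff, not_or]
          exact ⟨fun h ↦ h.2 (mem_inter.1 hwS).2, hw⟩
        have hlt : #(S \ Γ v ∪ R) < #S := by
          apply card_lt_card
          refine ⟨union_subset sdiff_subset (hRS.trans inter_subset_left), fun h ↦ hwn ?_⟩
          exact h (mem_inter.1 hwS).1
        have h1 := ih _ hlt _ rfl w hwn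
        rw [union_insert, hsplit, card_insert_of_notMem hw, pow_succ]
        nlinarith [ihR hRS]
    have h1 := hsub _ subset_rfl
    rw [sdiff_union_inter] at h1
    have hc : #(S ∩ Γ v) ≤ D - 1 := by
      have : #(S ∩ Γ v) < #(Γ v) := by
        apply card_lt_card
        exact ⟨inter_subset_right, fun h ↦ hv (mem_inter.1 (h (hΓ v))).1⟩
      have := hcard v
      omega
    have hQ0 : 0 ≤ Q (S \ Γ v) := measureReal_nonneg
    have h2 : Real.exp (-1) ≤ (1 - x) ^ #(S ∩ Γ v) :=
      (exp_neg_one_le_one_sub_inv_pow hD).trans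
        (pow_le_pow_of_le_one hx1.le (by linarith) hc)
    have hpx : p ≤ x * Real.exp (-1) := by
      rw [hx, Real.exp_neg, ← mul_inv, ← one_div, le_div_iff₀ (by positivity)]
      linarith
    calc μ.real (E v ∩ ⋂ u ∈ S, (E u)ᶜ)
        ≤ μ.real (E v ∩ ⋂ u ∈ S \ Γ v, (E u)ᶜ) := by
          refine measureReal_mono (Set.inter_subset_inter_right _ ?_)
          exact Set.biInter_subset_biInter_left fun u hu ↦ (mem_sdiff.1 hu).1
      _ = μ.real (E v) * Q (S \ Γ v) := hind _ _ sdiff_disjoint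
      _ ≤ x * Real.exp (-1) * Q (S \ Γ v) := by gcongr; exact (hp v).trans hpx
      _ ≤ x * ((1 - x) ^ #(S ∩ Γ v) * Q (S \ Γ v)) := by
          rw [mul_assoc]; gcongr
      _ ≤ x * Q S := by gcongr
  change 0 < Q S
  induction S using Finset.induction_on with
  | empty => simp [hQ]
  | insert v S hv ihS =>
    rw [hsplit]
    nlinarith [key _ S rfl v hv]

/-- Events in a product space determined by disjoint sets of coordinates are independent. -/
theorem measureReal_pi_inter_of_disjoint {ι α : Type*} [Fintype ι] [DecidableEq ι] [Finite α]
    [MeasurableSpace α] [DiscreteMeasurableSpace α] (μ : ι → Measure α)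
    [∀ i, IsProbabilityMeasure (μ i)] {S T : Finset ι} (hST : Disjoint S T) {E F : Set (ι → α)}
    (hE : ∀ ω ω', (∀ i ∈ S, ω i = ω' i) → ω ∈ E → ω' ∈ E)
    (hF : ∀ ω ω', (∀ i ∈ T, ω i = ω' i) → ω ∈ F → ω' ∈ F) :
    (Measure.pi μ).real (E ∩ F) = (Measure.pi μ).real E * (Measure.pi μ).real F := by
  have hi : iIndepFun (fun i (ω : ι → α) ↦ ω i) (Measure.pi μ) :=
    iIndepFun_pi (X := fun _ ↦ id) fun i ↦ aemeasurable_id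
  have h := hi.indepFun_finset S T hST fun i ↦ measurable_pi_apply i
  have himage (R : Finset ι) (A : Set (ι → α))
      (hA : ∀ ω ω', (∀ i ∈ R, ω i = ω' i) → ω ∈ A → ω' ∈ A) :
      (fun (ω : ι → α) (i : R) ↦ ω i) ⁻¹' ((fun (ω : ι → α) (i : R) ↦ ω i) '' A) = A := by
    ext ω
    constructor
    · rintro ⟨ω', hω', he⟩
      exact hA ω' ω (fun i hi ↦ congrFun he ⟨i, hi⟩) hω'
    · exact fun hω ↦ ⟨ω, hω, rfl⟩
  have h2 := h.measure_inter_preimage_eq_mul _ _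
    ((Set.toFinite ((fun (ω : ι → α) (i : S) ↦ ω i) '' E)).measurableSet)
    ((Set.toFinite ((fun (ω : ι → α) (i : T) ↦ ω i) '' F)).measurableSet)
  rw [himage S E hE, himage T F hF] at h2
  simp [measureReal_def, h2]

/-- Hoeffding's inequality for a `[0, 1]`-valued function of the coordinates of a product space. -/
theorem measureReal_pi_sum_sub_integral_ge_le {ι α : Type*} [Fintype ι] [Finite α]
    [MeasurableSpace α] [DiscreteMeasurableSpace α] (μ : ι → Measure α)
    [∀ i, IsProbabilityMeasure (μ i)] {f : α → ℝ} (hf : ∀ x, f x ∈ Set.Icc (0 : ℝ) 1)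
    (T : Finset ι) {ε : ℝ} (hε : 0 ≤ ε) :
    (Measure.pi μ).real {ω | ε ≤ ∑ i ∈ T, (f (ω i) - ∫ x, f x ∂μ i)} ≤
      Real.exp (-2 * ε ^ 2 / #T) := by
  have hi : iIndepFun (fun i (ω : ι → α) ↦ f (ω i) - ∫ x, f x ∂μ i) (Measure.pi μ) :=
    iIndepFun_pi (X := fun i x ↦ f x - ∫ x, f x ∂μ i) fun i ↦
      Measurable.of_discrete.aemeasurable
  have h := HasSubgaussianMGF.measure_sum_ge_le_of_iIndepFun hi (s := T)
    (c := fun _ ↦ (‖(1 : ℝ) - 0‖₊ / 2) ^ 2) ?_ hε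
  · refine h.trans_eq ?_
    congr 1
    simp
    rcases T.eq_empty_or_nonempty with rfl | hT
    · simp
    · have : (0 : ℝ) < #T := by exact_mod_cast hT.card_pos
      field_simp
  · intro i _
    have h1 := hasSubgaussianMGF_of_mem_Icc (μ := μ i) (X := f) (a := 0) (b := 1)
      Measurable.of_discrete.aemeasurable (Filter.Eventually.of_forall hf)
    have h2 := (measurePreserving_eval μ i).map_eq
    rw [← h2] at h1
    have h3 := HasSubgaussianMGF.of_map (μ := Measure.pi μ) (Y := Function.eval i)
      (measurable_pi_apply i).aemeasurable h1
    rw [h2] at h3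
    exact h3

/-- A set can be cut into `n` parts of sizes `⌊|Y| / n⌋` and `⌈|Y| / n⌉`. -/
theorem exists_finpartition_card_bounds {V : Type*} [DecidableEq V] (Y : Finset V) {n : ℕ}
    (hn : 0 < n) (hnY : n ≤ #Y) :
    ∃ P : Finpartition Y, #P.parts = n ∧
      ∀ t ∈ P.parts, #Y / n ≤ #t ∧ #t ≤ ⌈(#Y : ℝ) / (n : ℝ)⌉₊ := by
  obtain ⟨P, hP, rfl⟩ := Finpartition.exists_equipartition_card_eq Y hn.ne' hnY
  refine ⟨P, rfl, fun t ht ↦ ⟨hP.average_le_card_part ht, ?_⟩⟩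
  have hn' : (0 : ℝ) < #P.parts := by exact_mod_cast hn
  have hfloor : #Y / #P.parts ≤ ⌈(#Y : ℝ) / (#P.parts : ℝ)⌉₊ := by
    have : ((#Y / #P.parts : ℕ) : ℝ) ≤ (#Y : ℝ) / (#P.parts : ℝ) := Nat.cast_div_le
    exact_mod_cast this.trans (Nat.le_ceil _)
  rcases hP.card_parts_eq_average ht with h | h
  · omega
  · have h1 := hP.card_large_parts_eq_mod
    have h2 : 0 < #Y % #P.parts := by
      rw [← h1]
      exact card_pos.2 ⟨t, mem_filter.2 ⟨ht, h⟩⟩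
    rw [h, Nat.succ_le_iff, Nat.lt_ceil, lt_div_iff₀ hn']
    have h3 := Nat.div_add_mod #Y #P.parts
    have : #Y / #P.parts * #P.parts < #Y := by rw [mul_comm]; omega
    exact_mod_cast this

open Classical in
/-- A random transversal of a partition meets `N`, and misses `N`, about as often as expected. -/
theorem measureReal_transversal_count_le {V : Type*} [Fintype V] [DecidableEq V] [MeasurableSpace V]
    [DiscreteMeasurableSpace V] {Y : Finset V} (P : Finpartition Y) (N : Set V) {a b : ℕ}
    (ha : 0 < a) (hab : a ≤ b) (hP : ∀ t ∈ P.parts, 2 ≤ #t ∧ 2 * a * #t ≤ 3 * (a + b)) :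
    (Measure.pi fun t : {t // t ∈ P.parts} ↦ uniformOn (t.1 : Set V)).real
      {ω | (#{t | (∃ y ∈ t.1, y ∈ N) ∧ ω t ∈ N} : ℝ) < a / (3 * (a + b)) * #{y ∈ Y | y ∈ N} ∨
        (#{y ∈ Y | y ∈ N} : ℝ) - #{t | (∃ y ∈ t.1, y ∈ N) ∧ ω t ∈ N} <
          b / (3 * (a + b)) * #{y ∈ Y | y ∈ N}} ≤
      2 * Real.exp (-((a : ℝ) ^ 2 / (5 * (a + b : ℝ) ^ 2) * #{y ∈ Y | y ∈ N})) := by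
  set d : ℝ := ((#{y ∈ Y | y ∈ N} : ℕ) : ℝ) with hd
  let T : Finset {t // t ∈ P.parts} := {t | ∃ y ∈ t.1, y ∈ N}
  let μ : {t // t ∈ P.parts} → Measure V := fun t ↦ uniformOn (t.1 : Set V)
  have hμ (t) : IsProbabilityMeasure (μ t) :=
    isProbabilityMeasure_uniformOn (Set.toFinite _) (P.nonempty_of_mem_parts t.2)
  let f : V → ℝ := N.indicator 1
  have hf (x : V) : f x ∈ Set.Icc (0 : ℝ) 1 := by
    by_cases hx : x ∈ N <;> simp [f, hx]
  have hf' (x : V) : 1 - f x ∈ Set.Icc (0 : ℝ) 1 := by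
    by_cases hx : x ∈ N <;> simp [f, hx]
  let c : {t // t ∈ P.parts} → ℝ := fun t ↦ #{y ∈ t.1 | y ∈ N}
  have hint (t) : ∫ x, f x ∂μ t = c t / #t.1 := by
    rw [integral_indicator_one (Set.toFinite N).measurableSet]
    have h := uniformOn_apply_finset (s := t.1) (t := N.toFinset)
    simp only [Set.coe_toFinset] at h
    simp only [μ, c, measureReal_def, h]
    have he : t.1 ∩ N.toFinset = {y ∈ t.1 | y ∈ N} := by
      ext y
      simp
    simp [ENNReal.toReal_div, he]
  have hint' (t) : ∫ x, (1 - f x) ∂μ t = 1 - ∫ x, f x ∂μ t := by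
    rw [integral_sub (integrable_const _) Integrable.of_finite]
    simp
  have hcount (ω : {t // t ∈ P.parts} → V) :
      (#{t | (∃ y ∈ t.1, y ∈ N) ∧ ω t ∈ N} : ℝ) = ∑ t ∈ T, f (ω t) := by
    simp only [f, T, Set.indicator_apply, Pi.one_apply]
    rw [Finset.sum_boole, filter_filter]
  have hdT : ∑ t ∈ T, c t = d := by
    have h1 : ∑ t ∈ T, c t = ∑ t, c t := by
      refine sum_subset (subset_univ _) fun t _ ht ↦ ?_
      simp only [T, mem_filter, mem_univ, true_and, not_exists, not_and] at ht
      simp only [c, Nat.cast_eq_zero, card_eq_zero]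
      exact filter_eq_empty_iff.2 fun {y} hy ↦ ht y hy
    have h2 : ({y ∈ Y | y ∈ N} : Finset V) = P.parts.biUnion fun t ↦ {y ∈ t | y ∈ N} := by
      rw [← filter_biUnion]
      congr 1
      exact P.biUnion_parts.symm
    rw [h1, hd, h2, card_biUnion]
    · rw [← sum_coe_sort P.parts]
      simp [c]
    · intro s hs t ht hst
      exact disjoint_filter_filter (P.disjoint hs ht hst)
  have hTd : (#T : ℝ) ≤ d := by
    rw [← hdT, card_eq_sum_ones]
    push_cast
    refine sum_le_sum fun t ht ↦ ?_
    obtain ⟨y, hy, hyN⟩ := (mem_filter.1 ht).2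
    have : 0 < #{y ∈ t.1 | y ∈ N} := card_pos.2 ⟨y, mem_filter.2 ⟨hy, hyN⟩⟩
    simp only [c]
    exact_mod_cast this
  have ha' : (0 : ℝ) < a := by exact_mod_cast ha
  have hab' : (a : ℝ) ≤ b := by exact_mod_cast hab
  have hd0 : 0 ≤ d := by positivity
  have hlow : 2 * a / (3 * (a + b)) * d ≤ ∑ t ∈ T, ∫ x, f x ∂μ t := by
    rw [← hdT, mul_sum]
    refine sum_le_sum fun t _ ↦ ?_
    rw [hint, div_mul_eq_mul_div]
    obtain ⟨h2, h3⟩ := hP t.1 t.2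
    have h2' : (2 : ℝ) ≤ #t.1 := by exact_mod_cast h2
    have h3' : 2 * (a : ℝ) * #t.1 ≤ 3 * (a + b) := by exact_mod_cast h3
    have hc : 0 ≤ c t := by positivity
    rw [div_le_div_iff₀ (by positivity) (by positivity)]
    nlinarith
  have hupp : ∑ t ∈ T, ∫ x, f x ∂μ t ≤ d / 2 := by
    rw [← hdT, sum_div]
    refine sum_le_sum fun t _ ↦ ?_
    rw [hint]
    have h2' : (2 : ℝ) ≤ #t.1 := by exact_mod_cast (hP t.1 t.2).1
    gcongr
  set ε : ℝ := a / (3 * (a + b)) * d with hε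
  have hε0 : 0 ≤ ε := by positivity
  have hexp : Real.exp (-2 * ε ^ 2 / #T) ≤
      Real.exp (-((a : ℝ) ^ 2 / (5 * (a + b : ℝ) ^ 2) * d)) := by
    rw [Real.exp_le_exp]
    rcases T.eq_empty_or_nonempty with hT | hT
    · have : d = 0 := by rw [← hdT, hT, sum_empty]
      simp [this, hT]
    · have hT' : (0 : ℝ) < #T := by exact_mod_cast hT.card_pos
      rw [div_le_iff₀ hT']
      have h1 : (a : ℝ) ^ 2 / (5 * (a + b : ℝ) ^ 2) * d * #T ≤
          (a : ℝ) ^ 2 / (5 * (a + b : ℝ) ^ 2) * d * d := by gcongr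
      have h2 : ε ^ 2 = 5 / 9 * ((a : ℝ) ^ 2 / (5 * (a + b : ℝ) ^ 2) * d * d) := by
        rw [hε]; field_simp; ring
      have h3 : 0 ≤ (a : ℝ) ^ 2 / (5 * (a + b : ℝ) ^ 2) * d * d := by positivity
      nlinarith
  have hbd : (b : ℝ) / (3 * (a + b)) * d = d / 3 - ε := by
    rw [hε]; field_simp; ring
  have hεd : 2 * a / (3 * (a + b)) * d = 2 * ε := by
    rw [hε]; ring
  calc _ ≤ (Measure.pi μ).real
        ({ω | ε ≤ ∑ t ∈ T, (1 - f (ω t) - ∫ x, (1 - f x) ∂μ t)} ∪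
          {ω | ε ≤ ∑ t ∈ T, (f (ω t) - ∫ x, f x ∂μ t)}) := by
        refine measureReal_mono fun ω hω ↦ ?_
        simp only [Set.mem_ofPred_eq, hcount] at hω
        simp only [hint', Set.mem_union, Set.mem_ofPred_eq, sum_sub_distrib]
        rcases hω with h | h
        · left; linarith
        · right; linarith
    _ ≤ _ := measureReal_union_le _ _
    _ ≤ Real.exp (-2 * ε ^ 2 / #T) + Real.exp (-2 * ε ^ 2 / #T) :=
        add_le_add (measureReal_pi_sum_sub_integral_ge_le μ hf' T hε0)
          (measureReal_pi_sum_sub_integral_ge_le μ hf T hε0)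
    _ ≤ _ := by linarith

/-- The case `a ≤ b` of the splitting theorem. -/
theorem exists_neighborSet_split_of_le {V : Type*} [Fintype V] [DecidableEq V]
    (G : SimpleGraph V) (Δ : ℕ) (hΔ : ∀ v, (G.neighborSet v).ncard ≤ Δ)
    (Y : Finset V) (a b : ℕ) (ha : 0 < a) (hab : a ≤ b) (hY : #Y = a + b)
    (δ : ℝ) (hδ : ∀ v : V, δ ≤ ((G.neighborSet v ∩ ↑Y).ncard : ℝ))
    (hcond : (Δ : ℝ) ^ 2 * (⌈((a + b : ℕ) : ℝ) / (a : ℝ)⌉₊ : ℝ) * 2 *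
        Real.exp (1 - (a : ℝ) ^ 2 / (5 * ((a + b : ℕ) : ℝ) ^ 2) * δ) < 1) :
    ∃ A B : Finset V, Disjoint A B ∧ A ∪ B = Y ∧ #A = a ∧ #B = b ∧
      (∀ v : V, (a : ℝ) / (3 * (a + b)) * ((G.neighborSet v ∩ ↑Y).ncard : ℝ) ≤
        ((G.neighborSet v ∩ ↑A).ncard : ℝ)) ∧
      (∀ v : V, (b : ℝ) / (3 * (a + b)) * ((G.neighborSet v ∩ ↑Y).ncard : ℝ) ≤
        ((G.neighborSet v ∩ ↑B).ncard : ℝ)) := by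
  classical
  have hncard (v : V) (X : Finset V) :
      (G.neighborSet v ∩ ↑X).ncard = #{y ∈ X | y ∈ G.neighborSet v} := by
    rw [← Set.ncard_coe_finset]
    congr 1
    ext y
    simp [and_comm]
  simp only [hncard] at hδ ⊢
  have ha' : (0 : ℝ) < a := by exact_mod_cast ha
  have hab' : (a : ℝ) ≤ b := by exact_mod_cast hab
  rcases Nat.eq_zero_or_pos Δ with rfl | hΔ0
  · have h0 (v : V) (X : Finset V) : #{y ∈ X | y ∈ G.neighborSet v} = 0 := by
      have := hΔ v
      rw [Nat.le_zero, Set.ncard_eq_zero (Set.toFinite _)] at this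
      simp [this]
    obtain ⟨A, hAY, hA⟩ := exists_subset_card_eq (show a ≤ #Y by omega)
    refine ⟨A, Y \ A, disjoint_sdiff, union_sdiff_of_subset hAY, hA, ?_, ?_, ?_⟩
    · rw [card_sdiff_of_subset hAY]; omega
    · simp only [h0]; simp
    · simp only [h0]; simp
  set k : ℕ := ⌈((a + b : ℕ) : ℝ) / (a : ℝ)⌉₊ with hk
  set x : ℝ := (a : ℝ) ^ 2 / (5 * ((a + b : ℕ) : ℝ) ^ 2) with hx
  have hx0 : 0 ≤ x := by positivity
  have hk2 : 2 ≤ k := by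
    rw [Nat.succ_le_iff, hk, Nat.lt_ceil, lt_div_iff₀ ha']
    push_cast
    linarith
  have hka : 2 * a * k ≤ 3 * (a + b) := by
    have h1 : (k : ℝ) < ((a + b : ℕ) : ℝ) / (a : ℝ) + 1 := Nat.ceil_lt_add_one (by positivity)
    rw [div_add_one ha'.ne', lt_div_iff₀ ha'] at h1
    have h2 : k * a < a + b + a := by exact_mod_cast h1
    nlinarith
  have hD2 : 2 ≤ Δ * (k * Δ) := by nlinarith [Nat.mul_le_mul hΔ0 (Nat.mul_le_mul hk2 hΔ0)]
  have hcond' : Real.exp 1 * (2 * Real.exp (-(x * δ))) * (Δ * (k * Δ) : ℕ) ≤ 1 := by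
    rw [sub_eq_add_neg, Real.exp_add] at hcond
    push_cast
    linarith
  have hδ0 : 0 < δ := by
    by_contra! hle
    have h1 : 1 ≤ Real.exp (-(x * δ)) := Real.one_le_exp (by nlinarith)
    have h2 : 1 ≤ Real.exp 1 := Real.one_le_exp zero_le_one
    have h3 : (2 : ℝ) ≤ (Δ * (k * Δ) : ℕ) := by exact_mod_cast hD2
    nlinarith [mul_le_mul h2 h1 zero_le_one (by positivity)]
  obtain ⟨P, hPcard, hP⟩ := exists_finpartition_card_bounds Y ha (by omega)
  rw [hY, ← hk] at hP
  have hP2 (t) (ht : t ∈ P.parts) : 2 ≤ #t ∧ 2 * a * #t ≤ 3 * (a + b) := by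
    obtain ⟨h1, h2⟩ := hP t ht
    refine ⟨le_trans ?_ h1, le_trans ?_ hka⟩
    · rw [Nat.le_div_iff_mul_le ha]; omega
    · gcongr
  let _ : MeasurableSpace V := ⊤
  let μ : {t // t ∈ P.parts} → Measure V := fun t ↦ uniformOn (t.1 : Set V)
  have hμ (t) : IsProbabilityMeasure (μ t) :=
    isProbabilityMeasure_uniformOn (Set.toFinite _) (P.nonempty_of_mem_parts t.2)
  let N : V → Set V := fun v ↦ G.neighborSet v
  let d : V → ℕ := fun v ↦ #{y ∈ Y | y ∈ N v}
  let T : V → Finset {t // t ∈ P.parts} := fun v ↦ {t | ∃ y ∈ t.1, y ∈ N v}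
  let X : V → ({t // t ∈ P.parts} → V) → ℕ := fun v ω ↦
    #{t | (∃ y ∈ t.1, y ∈ N v) ∧ ω t ∈ N v}
  let E : V → Set ({t // t ∈ P.parts} → V) := fun v ↦
    {ω | (X v ω : ℝ) < a / (3 * (a + b)) * d v ∨
      (d v : ℝ) - X v ω < b / (3 * (a + b)) * d v}
  have hET (v : V) (ω ω' : {t // t ∈ P.parts} → V) (h : ∀ t ∈ T v, ω t = ω' t) :
      ω ∈ E v ↔ ω' ∈ E v := by
    have : X v ω = X v ω' := by
      simp only [X]
      congr 1
      refine filter_congr fun t _ ↦ and_congr_right fun ht ↦ ?_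
      rw [h t (mem_filter.2 ⟨mem_univ t, ht⟩)]
    simp only [E, Set.mem_ofPred_eq, this]
  let Γ : V → Finset V := fun v ↦ {w | ¬ Disjoint (T v) (T w)}
  have hLLL := lovasz_local_lemma_symmetric (Measure.pi μ) E
    (fun v ↦ (Set.toFinite (E v)).measurableSet) Γ ?_ hD2 ?_
    (p := 2 * Real.exp (-(x * δ))) ?_ hcond' ?_ univ
  · have hae : ∀ᵐ ω ∂Measure.pi μ, ∀ t, ω t ∈ t.1 := by
      rw [ae_all_iff]
      intro t
      exact (measurePreserving_eval μ t).quasiMeasurePreserving.ae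
        (ae_cond_mem (μ := Measure.count) (Set.toFinite (t.1 : Set V)).measurableSet)
    have hne : Measure.pi μ (⋂ u ∈ univ, (E u)ᶜ) ≠ 0 := fun h ↦ by
      rw [measureReal_def, h] at hLLL
      simp at hLLL
    obtain ⟨ω, hω, hωt⟩ := ((frequently_ae_mem_iff.2 hne).and_eventually hae).exists
    have hinj : Function.Injective ω := fun s t hst ↦ Subtype.ext <|
      P.disjoint.elim_finset s.2 t.2 (ω s) (hωt s) (hst ▸ hωt t)
    have hAY : univ.image ω ⊆ Y := by
      intro y hy
      obtain ⟨t, -, rfl⟩ := mem_image.1 hy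
      exact P.le t.2 (hωt t)
    have hAcard : #(univ.image ω) = a := by
      rw [card_image_of_injective _ hinj, card_univ, Fintype.card_coe, hPcard]
    have hXA (v : V) : #{y ∈ univ.image ω | y ∈ N v} = X v ω := by
      rw [filter_image, card_image_of_injective _ hinj]
      congr 1
      refine filter_congr fun t _ ↦ ?_
      exact ⟨fun h ↦ ⟨⟨ω t, hωt t, h⟩, h⟩, fun h ↦ h.2⟩
    have hXB (v : V) : (#{y ∈ Y \ univ.image ω | y ∈ N v} : ℝ) = d v - X v ω := by
      have h1 : {y ∈ Y \ univ.image ω | y ∈ N v} =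
          {y ∈ Y | y ∈ N v} \ {y ∈ univ.image ω | y ∈ N v} := by
        ext y
        simp only [mem_filter, mem_sdiff]
        tauto
      rw [h1, card_sdiff_of_subset (filter_subset_filter _ hAY), hXA,
        Nat.cast_sub (hXA v ▸ card_le_card (filter_subset_filter _ hAY))]
    have hgood (v : V) : (a : ℝ) / (3 * (a + b)) * d v ≤ X v ω ∧
        (b : ℝ) / (3 * (a + b)) * d v ≤ d v - X v ω := by
      have := Set.mem_iInter₂.1 hω v (mem_univ v)
      simpa only [E, Set.mem_compl_iff, Set.mem_ofPred_eq, not_or, not_lt] using this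
    refine ⟨univ.image ω, Y \ univ.image ω, disjoint_sdiff, union_sdiff_of_subset hAY, hAcard,
      ?_, fun v ↦ ?_, fun v ↦ ?_⟩
    · rw [card_sdiff_of_subset hAY]; omega
    · rw [hXA v]
      exact (hgood v).1
    · rw [hXB v]
      exact (hgood v).2
  · intro v
    have h1 : (0 : ℝ) < d v := hδ0.trans_le (hδ v)
    have h2 : 0 < d v := by exact_mod_cast h1
    obtain ⟨y, hy⟩ := card_pos.1 h2
    obtain ⟨hyY, hyN⟩ := mem_filter.1 hy
    obtain ⟨t, ht, hyt⟩ := P.exists_mem hyY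
    have hT : ⟨t, ht⟩ ∈ T v := mem_filter.2 ⟨mem_univ _, y, hyt, hyN⟩
    exact mem_filter.2 ⟨mem_univ _, not_disjoint_iff.2 ⟨_, hT, hT⟩⟩
  · intro v
    have hN (v : V) : #(N v).toFinset ≤ Δ := by
      rw [← Set.ncard_eq_toFinset_card']
      exact hΔ v
    have hsub : Γ v ⊆ {y ∈ Y | y ∈ N v}.biUnion fun y ↦
        (P.part y).biUnion fun z ↦ (N z).toFinset := by
      intro w hw
      obtain ⟨t, htv, htw⟩ := not_disjoint_iff.1 (mem_filter.1 hw).2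
      obtain ⟨-, y, hyt, hyv⟩ := mem_filter.1 htv
      obtain ⟨-, z, hzt, hzw⟩ := mem_filter.1 htw
      refine mem_biUnion.2 ⟨y, mem_filter.2 ⟨P.le t.2 hyt, hyv⟩, mem_biUnion.2 ⟨z, ?_, ?_⟩⟩
      · rwa [P.part_eq_of_mem t.2 hyt]
      · exact Set.mem_toFinset.2 (G.adj_symm hzw)
    refine (card_le_card hsub).trans ((card_biUnion_le_card_mul _ _ (k * Δ) fun y hy ↦ ?_).trans ?_)
    · refine (card_biUnion_le_card_mul _ _ Δ fun z _ ↦ hN z).trans ?_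
      gcongr
      exact (hP _ (P.part_mem.2 (mem_filter.1 hy).1)).2
    · gcongr
      refine (card_le_card fun y hy ↦ ?_).trans (hN v)
      simpa using (mem_filter.1 hy).2
  · intro v
    refine (measureReal_transversal_count_le P (N v) ha hab hP2).trans ?_
    rw [hx]
    push_cast
    gcongr
    exact hδ v
  · intro v S hS
    refine measureReal_pi_inter_of_disjoint μ (S := T v) (T := S.biUnion T) ?_
      (fun ω ω' h ↦ (hET v ω ω' h).1) fun ω ω' h hω ↦ ?_
    · rw [disjoint_biUnion_right]
      intro u hu
      by_contra hdis
      exact disjoint_left.1 hS hu (mem_filter.2 ⟨mem_univ _, hdis⟩)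
    · refine Set.mem_iInter₂.2 fun u hu hu' ↦ Set.mem_iInter₂.1 hω u hu ?_
      exact (hET u ω ω' fun t ht ↦ h t (mem_biUnion.2 ⟨u, hu, ht⟩)).2 hu'

/-- Let `G` be a graph with maximum degree at most `Δ`, `Y` a set of `m = a + b` vertices
(`a, b > 0`), and suppose every vertex has at least `δ` neighbours in `Y`. If
`Δ²⌈m/min{a,b}⌉·2·e^{1 - (min{a,b}²/5m²)δ} < 1`, then `Y` can be partitioned as `A ∪ B`
with `|A| = a`, `|B| = b`, `d(v,A) ≥ (a/3m)d(v,Y)` and `d(v,B) ≥ (b/3m)d(v,Y)` for all `v`. -/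
theorem stmt7 {V : Type*} [Fintype V] [DecidableEq V] (G : SimpleGraph V) (Δ : ℕ)
    (hΔ : ∀ v, (G.neighborSet v).ncard ≤ Δ)
    (Y : Finset V) (a b : ℕ) (ha : 0 < a) (hb : 0 < b) (hY : Y.card = a + b)
    (δ : ℝ) (hδ : ∀ v : V, δ ≤ ((G.neighborSet v ∩ ↑Y).ncard : ℝ))
    (hcond : (Δ : ℝ) ^ 2 * (⌈((a + b : ℕ) : ℝ) / ((min a b : ℕ) : ℝ)⌉₊ : ℝ) * 2 *
        Real.exp (1 - ((min a b : ℕ) : ℝ) ^ 2 / (5 * ((a + b : ℕ) : ℝ) ^ 2) * δ) < 1) :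
    ∃ A B : Finset V, Disjoint A B ∧ A ∪ B = Y ∧ A.card = a ∧ B.card = b ∧
      (∀ v : V, (a : ℝ) / (3 * (a + b)) * ((G.neighborSet v ∩ ↑Y).ncard : ℝ) ≤
        ((G.neighborSet v ∩ ↑A).ncard : ℝ)) ∧
      (∀ v : V, (b : ℝ) / (3 * (a + b)) * ((G.neighborSet v ∩ ↑Y).ncard : ℝ) ≤
        ((G.neighborSet v ∩ ↑B).ncard : ℝ)) := by
  rcases le_total a b with hab | hab
  · rw [min_eq_left hab] at hcond
    exact exists_neighborSet_split_of_le G Δ hΔ Y a b ha hab hY δ hδ hcond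
  · rw [min_eq_right hab, add_comm a b] at hcond
    obtain ⟨A, B, hd, hu, hA, hB, h1, h2⟩ :=
      exists_neighborSet_split_of_le G Δ hΔ Y b a hb hab (by omega) δ hδ hcond
    rw [add_comm (b : ℝ) a] at h1 h2
    exact ⟨B, A, hd.symm, by rw [union_comm, hu], hB, hA, h2, h1⟩
end

section
/- For any ε > 0 there exist β = β(ε) > 0 and n₀ = n₀(ε) ∈ ℕ such that the following holds for any l, k ∈ ℕ. For every tree T with n ≥ n₀ vertices having l vertex-disjoint teeth of length k, there are subtrees S, T₁, T₂ of T covering T such that |V(S)| ≤ εn, S has at least βl − 1 vertex-disjoint teeth of length k which are also teeth of T, and T₁ and T₂ are vertex-disjoint and each intersects S in exactly one vertex. -/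
/-- `W` spans a subtree of the tree `T`: the induced subgraph on `W` is nonempty and
connected (hence, inside a tree, it is a subtree). -/
def IsSubtree {V : Type*} (T : SimpleGraph V) (W : Finset V) : Prop :=
  W.Nonempty ∧ (T.induce (↑W : Set V)).Connected

/-- A bare path in `T`: a path all of whose interior vertices have degree 2 in `T`. -/
def IsBarePath {V : Type*} (T : SimpleGraph V) {u v : V} (w : T.Walk u v) : Prop :=
  w.IsPath ∧ ∀ x ∈ w.support, x ≠ u → x ≠ v → (T.neighborSet x).ncard = 2

/-- A tooth in `T`: a bare path one of whose ends is a leaf of `T`. -/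
def IsTooth {V : Type*} (T : SimpleGraph V) {u v : V} (w : T.Walk u v) : Prop :=
  IsBarePath T w ∧ (T.neighborSet v).ncard = 1

/-- `T` has `m` pairwise vertex-disjoint teeth of length `k`. -/
def HasDisjTeeth {V : Type*} (T : SimpleGraph V) (k m : ℕ) : Prop :=
  ∃ (u v : Fin m → V) (w : ∀ i, T.Walk (u i) (v i)),
    (∀ i, IsTooth T (w i) ∧ (w i).length = k) ∧
    ∀ i j, i ≠ j → (w i).support.Disjoint (w j).support

/-- The walk `w` is a tooth of the subtree of `T` spanned by `S`: it lies in `S`, is a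
path, its interior vertices have degree 2 in the subtree spanned by `S`, and its final
vertex is a leaf of that subtree. -/
def IsToothIn {V : Type*} (T : SimpleGraph V) (S : Finset V) {u v : V} (w : T.Walk u v) :
    Prop :=
  (∀ x ∈ w.support, x ∈ S) ∧ w.IsPath ∧
  (∀ x ∈ w.support, x ≠ u → x ≠ v → (T.neighborSet x ∩ ↑S).ncard = 2) ∧
  (T.neighborSet v ∩ ↑S).ncard = 1

/-- `T` has `m` pairwise vertex-disjoint teeth of length `k` which lie in `S` and are
teeth both of `T` and of the subtree spanned by `S`. -/
def HasDisjTeethIn {V : Type*} (T : SimpleGraph V) (S : Finset V) (k m : ℕ) : Prop :=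
  ∃ (u v : Fin m → V) (w : ∀ i, T.Walk (u i) (v i)),
    (∀ i, IsTooth T (w i) ∧ IsToothIn T S (w i) ∧ (w i).length = k) ∧
    ∀ i j, i ≠ j → (w i).support.Disjoint (w j).support

/-- `p` and `d` are the parent map (fixing `r`) and the depth function of the graph `T`, seen as
a tree rooted at `r`. -/
structure IsRooting {V : Type*} (T : SimpleGraph V) (r : V) (p : V → V) (d : V → ℕ) : Prop where
  map_root : p r = r
  adj_parent : ∀ v, v ≠ r → T.Adj v (p v)
  depth_eq : ∀ v, v ≠ r → d v = d (p v) + 1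
  parent_or : ∀ v w, T.Adj v w → p v = w ∨ p w = v

theorem SimpleGraph.IsTree.exists_isRooting {V : Type*} {T : SimpleGraph V} (hT : T.IsTree)
    (r : V) : ∃ p d, IsRooting T r p d := by
  choose f hf hf' using hT.existsUnique_path r
  have key : ∀ v w, T.Adj w v → w ∈ (f v).support →
      (f v).penultimate = w ∧ (f v).length = (f w).length + 1 := by
    intro v w h hw
    rw [hT.isAcyclic.path_concat (hf w) (hf v) h hw]
    simp
  refine ⟨fun v => (f v).penultimate, fun v => (f v).length, ?_, ?_, ?_, ?_⟩
  · have h : (SimpleGraph.Walk.nil : T.Walk r r) = f r :=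
      hf' r _ SimpleGraph.Walk.IsPath.nil
    simp [← h]
  · intro v hv
    exact ((f v).adj_penultimate (SimpleGraph.Walk.not_nil_of_ne hv.symm)).symm
  · intro v hv
    exact (key v _ ((f v).adj_penultimate (SimpleGraph.Walk.not_nil_of_ne hv.symm))
      ((f v).getVert_mem_support _)).2
  · intro v w h
    by_cases hw : w ∈ (f v).support
    · exact Or.inl (key v w h.symm hw).1
    · exact Or.inr (key w v h
        (hT.isAcyclic.mem_support_of_ne_mem_support_of_adj_of_isPath (hf w) (hf v) h.symm hw)).1

/-- `a` is an ancestor of `w` (possibly `w` itself) with respect to the parent map `p`. -/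
def IsAncestor {V : Type*} (p : V → V) (a w : V) : Prop := ∃ k : ℕ, p^[k] w = a

namespace IsAncestor

variable {V : Type*} {p : V → V}

theorem refl (a : V) : IsAncestor p a a := ⟨0, rfl⟩

theorem parent (a : V) : IsAncestor p (p a) a := ⟨1, rfl⟩

theorem trans {a b c : V} (h₁ : IsAncestor p a b) (h₂ : IsAncestor p b c) :
    IsAncestor p a c := by
  obtain ⟨i, rfl⟩ := h₁
  obtain ⟨j, rfl⟩ := h₂
  exact ⟨i + j, Function.iterate_add_apply p i j c⟩

theorem eq_or_parent {a w : V} (h : IsAncestor p a w) : a = w ∨ IsAncestor p a (p w) := by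
  obtain ⟨k, rfl⟩ := h
  cases k with
  | zero => exact Or.inl rfl
  | succ k => exact Or.inr ⟨k, rfl⟩

theorem total {a b w : V} (ha : IsAncestor p a w) (hb : IsAncestor p b w) :
    IsAncestor p a b ∨ IsAncestor p b a := by
  obtain ⟨i, rfl⟩ := ha
  obtain ⟨j, rfl⟩ := hb
  rcases le_total i j with h | h
  · right
    refine ⟨j - i, ?_⟩
    rw [← Function.iterate_add_apply, Nat.sub_add_cancel h]
  · left
    refine ⟨i - j, ?_⟩
    rw [← Function.iterate_add_apply, Nat.sub_add_cancel h]

/-- A proper ancestor of `w` has a child which is an ancestor of `w`. -/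
theorem exists_child {b w : V} (h : IsAncestor p b w) (hne : b ≠ w) :
    ∃ c, p c = b ∧ c ≠ b ∧ IsAncestor p c w := by
  obtain ⟨k, hk⟩ := h
  induction k with
  | zero => exact absurd hk.symm hne
  | succ k ih =>
    by_cases hb : p^[k] w = b
    · exact ih hb
    · exact ⟨p^[k] w, by rw [← Function.iterate_succ_apply' p, hk], hb, k, rfl⟩

end IsAncestor

namespace IsRooting

variable {V : Type*} {T : SimpleGraph V} {r : V} {p : V → V} {d : V → ℕ}

theorem ne_root_of_child (hR : IsRooting T r p d) {b c : V} (hc : p c = b) (hne : c ≠ b) :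
    c ≠ r := by
  rintro rfl
  exact hne (hR.map_root.symm.trans hc)

theorem depth_child (hR : IsRooting T r p d) {b c : V} (hc : p c = b) (hne : c ≠ b) :
    d c = d b + 1 := by
  rw [hR.depth_eq c (hR.ne_root_of_child hc hne), hc]

theorem depth_parent_le (hR : IsRooting T r p d) (v : V) : d (p v) ≤ d v := by
  by_cases h : v = r
  · rw [h, hR.map_root]
  · rw [hR.depth_eq v h]
    exact Nat.le_succ _

theorem depth_le (hR : IsRooting T r p d) {a w : V} (h : IsAncestor p a w) : d a ≤ d w := by
  obtain ⟨k, rfl⟩ := h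
  induction k with
  | zero => exact le_rfl
  | succ k ih =>
    rw [Function.iterate_succ_apply']
    exact (hR.depth_parent_le _).trans ih

theorem depth_lt (hR : IsRooting T r p d) {a w : V} (h : IsAncestor p a w) (hne : a ≠ w) :
    d a < d w := by
  obtain ⟨c, hc, hcne, hcw⟩ := h.exists_child hne
  have h₁ := hR.depth_child hc hcne
  have h₂ := hR.depth_le hcw
  omega

theorem antisymm (hR : IsRooting T r p d) {a b : V} (h₁ : IsAncestor p a b)
    (h₂ : IsAncestor p b a) : a = b := by
  by_contra h
  exact absurd (hR.depth_lt h₁ h) (not_lt.2 (hR.depth_le h₂))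

theorem isAncestor_root (hR : IsRooting T r p d) (w : V) : IsAncestor p r w := by
  induction h : d w generalizing w with
  | zero =>
    by_cases hw : w = r
    · exact hw ▸ IsAncestor.refl _
    · have := hR.depth_eq w hw
      omega
  | succ n ih =>
    by_cases hw : w = r
    · exact hw ▸ IsAncestor.refl _
    · have := hR.depth_eq w hw
      exact (ih (p w) (by omega)).trans (IsAncestor.parent w)

theorem eq_root (hR : IsRooting T r p d) {a : V} (h : IsAncestor p a r) : a = r :=
  hR.antisymm h (hR.isAncestor_root a)

theorem not_isAncestor_parent (hR : IsRooting T r p d) {v : V} (hv : v ≠ r) :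
    ¬ IsAncestor p v (p v) := by
  intro h
  have h₁ := hR.depth_le h
  have h₂ := hR.depth_eq v hv
  omega

/-- Neighbours of descendants of `b` are descendants of `b`, except for the parent of `b`. -/
theorem isAncestor_of_adj (hR : IsRooting T r p d) {b v w : V} (h : T.Adj v w)
    (hv : IsAncestor p b v) : IsAncestor p b w ∨ (v = b ∧ w = p b) := by
  rcases hR.parent_or v w h with rfl | rfl
  · rcases hv.eq_or_parent with rfl | h'
    · exact Or.inr ⟨rfl, rfl⟩
    · exact Or.inl h'
  · exact Or.inl (hv.trans (IsAncestor.parent w))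

/-- A vertex set containing, with each of its vertices other than `x`, also the parent of that
vertex, spans a subtree. -/
theorem isSubtree (hR : IsRooting T r p d) {S : Finset V} {x : V} (hx : x ∈ S)
    (h : ∀ v ∈ S, v ≠ x → v ≠ r ∧ p v ∈ S) : IsSubtree T S := by
  refine ⟨⟨x, hx⟩, ?_⟩
  have key : ∀ n v, d v = n → ∀ hv : v ∈ S,
      (T.induce (↑S : Set V)).Reachable ⟨v, hv⟩ ⟨x, hx⟩ := by
    intro n
    induction n using Nat.strong_induction_on with
    | _ n ih =>
      intro v hd hv
      by_cases hvx : v = x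
      · subst hvx
        exact SimpleGraph.Reachable.refl _
      · obtain ⟨hr, hp⟩ := h v hv hvx
        have hdv := hR.depth_eq v hr
        have hadj : (T.induce (↑S : Set V)).Adj ⟨v, hv⟩ ⟨p v, hp⟩ := hR.adj_parent v hr
        exact hadj.reachable.trans (ih (d (p v)) (by omega) (p v) rfl hp)
  have : Nonempty (↑S : Set V) := ⟨⟨x, hx⟩⟩
  exact ⟨fun a b => (key _ a.1 rfl a.2).trans (key _ b.1 rfl b.2).symm⟩

/-- If a walk avoids `z` or its parent and meets the subtree below `z`, it lies inside it. -/
theorem isAncestor_of_mem_support (hR : IsRooting T r p d) {z u v : V} (w : T.Walk u v)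
    (hz : ¬ (z ∈ w.support ∧ p z ∈ w.support)) {x : V} (hx : x ∈ w.support)
    (hzx : IsAncestor p z x) : ∀ y ∈ w.support, IsAncestor p z y := by
  have key : ∀ {a b : V} (q : T.Walk a b), ¬ (z ∈ q.support ∧ p z ∈ q.support) →
      ∀ y ∈ q.support, (IsAncestor p z y ↔ IsAncestor p z a) := by
    intro a b q
    induction q with
    | nil =>
      intro _ y hy
      rw [SimpleGraph.Walk.support_nil, List.mem_singleton] at hy
      rw [hy]
    | @cons a b c hab q ih =>
      intro hq y hy
      rw [SimpleGraph.Walk.support_cons, List.mem_cons, List.mem_cons] at hq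
      rw [SimpleGraph.Walk.support_cons, List.mem_cons] at hy
      have hb := q.start_mem_support
      rcases hy with rfl | hy
      · rfl
      · rw [ih (fun h => hq ⟨Or.inr h.1, Or.inr h.2⟩) y hy]
        constructor
        · intro h
          rcases hR.isAncestor_of_adj hab.symm h with h | ⟨rfl, rfl⟩
          · exact h
          · exact absurd ⟨Or.inr hb, Or.inl rfl⟩ hq
        · intro h
          rcases hR.isAncestor_of_adj hab h with h | ⟨rfl, rfl⟩
          · exact h
          · exact absurd ⟨Or.inl rfl, Or.inr hb⟩ hq
  intro y hy
  rw [key w hz y hy, ← key w hz x hx]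
  exact hzx

end IsRooting

theorem exists_balanced_coloring {ι : Type*} [DecidableEq ι] (I : Finset ι) (s : ι → ℕ) (a K : ℕ)
    (hs : ∀ i ∈ I, s i ≤ a) (hsum : ∑ i ∈ I, s i ≤ K * a) :
    ∃ f : ι → Fin (K + 1), ∀ κ, ∑ i ∈ I with f i = κ, s i ≤ 2 * a := by
  induction I using Finset.induction_on with
  | empty => exact ⟨fun _ => 0, by simp⟩
  | insert j I hj ih =>
    rw [Finset.sum_insert hj] at hsum
    obtain ⟨f, hf⟩ := ih (fun i hi => hs i (Finset.mem_insert_of_mem hi)) (by omega)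
    obtain ⟨κ, hκ⟩ : ∃ κ, ∑ i ∈ I with f i = κ, s i ≤ a := by
      by_contra! hcon
      have h₁ : ∑ κ : Fin (K + 1), ∑ i ∈ I with f i = κ, s i = ∑ i ∈ I, s i :=
        Finset.sum_fiberwise I f s
      have h₂ : ∑ _κ : Fin (K + 1), (a + 1) ≤ ∑ κ : Fin (K + 1), ∑ i ∈ I with f i = κ, s i :=
        Finset.sum_le_sum fun κ _ => hcon κ
      rw [h₁] at h₂
      simp only [Finset.sum_const, Finset.card_univ, Fintype.card_fin, smul_eq_mul] at h₂
      nlinarith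
    refine ⟨Function.update f j κ, fun κ' => ?_⟩
    have hcongr : ∑ i ∈ I with Function.update f j κ i = κ', s i = ∑ i ∈ I with f i = κ', s i := by
      congr 1
      refine Finset.filter_congr fun i hi => ?_
      rw [Function.update_of_ne (ne_of_mem_of_not_mem hi hj)]
    rw [Finset.filter_insert, Function.update_self]
    split_ifs with h
    · rw [Finset.sum_insert (fun h => hj (Finset.mem_filter.1 h).1), hcongr, ← h]
      have := hs j (Finset.mem_insert_self j I)
      omega
    · rw [hcongr]
      exact hf κ'

open Classical in
/-- The vertices of the subtree hanging below `a`. -/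
noncomputable def descendants {V : Type*} [Fintype V] (p : V → V) (a : V) : Finset V :=
  Finset.univ.filter (IsAncestor p a)

@[simp] theorem mem_descendants {V : Type*} [Fintype V] {p : V → V} {a w : V} :
    w ∈ descendants p a ↔ IsAncestor p a w := by
  simp [descendants]

/-- A covering of `T` by subtrees `S, T₁, T₂` with `T₁, T₂` disjoint and meeting `S` in one vertex
each, such that `S` has at most `D` vertices and `m` disjoint teeth of length `k`. -/
def HasSplit {V : Type*} [Fintype V] [DecidableEq V] (T : SimpleGraph V) (D k m : ℕ) : Prop :=
  ∃ S T₁ T₂ : Finset V, IsSubtree T S ∧ IsSubtree T T₁ ∧ IsSubtree T T₂ ∧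
    S ∪ T₁ ∪ T₂ = Finset.univ ∧ S.card ≤ D ∧ HasDisjTeethIn T S k m ∧
    Disjoint T₁ T₂ ∧ (T₁ ∩ S).card = 1 ∧ (T₂ ∩ S).card = 1

theorem hasDisjTeethIn_card {V : Type*} {T : SimpleGraph V} {l k : ℕ} {u v : Fin l → V}
    {w : ∀ i, T.Walk (u i) (v i)} (hw : ∀ i, IsTooth T (w i) ∧ (w i).length = k)
    (hdisj : ∀ i j, i ≠ j → (w i).support.Disjoint (w j).support) {S : Finset V}
    {I : Finset (Fin l)}
    (hI : ∀ i ∈ I, ∀ x ∈ (w i).support, x ∈ S ∧ ∀ y, T.Adj x y → y ∈ S) :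
    HasDisjTeethIn T S k I.card := by
  let e := I.equivFin.symm
  refine ⟨fun j => u (e j), fun j => v (e j), fun j => w (e j), fun j => ?_, fun i j hij => ?_⟩
  · have hin := hI (e j) (e j).2
    have hnb : ∀ x ∈ (w (e j)).support, T.neighborSet x ∩ ↑S = T.neighborSet x := fun x hx =>
      Set.inter_eq_left.2 fun y hy => (hin x hx).2 y hy
    obtain ⟨⟨⟨hpath, hbare⟩, hleaf⟩, hlen⟩ := hw (e j)
    refine ⟨⟨⟨hpath, hbare⟩, hleaf⟩, ⟨fun x hx => (hin x hx).1, hpath, ?_, ?_⟩, hlen⟩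
    · intro x hx hxu hxv
      rw [hnb x hx]
      exact hbare x hx hxu hxv
    · rw [hnb _ (w (e j)).end_mem_support]
      exact hleaf
  · exact hdisj _ _ fun h => hij (e.injective (Subtype.ext h))

namespace IsRooting

variable {V : Type*} [Fintype V] [DecidableEq V] {T : SimpleGraph V} {r : V} {p : V → V}
  {d : V → ℕ}

/-- The split along the part of the tree lying between `t` and its descendant `b`. -/
theorem hasSplit_between (hR : IsRooting T r p d) {l k D : ℕ} {u v : Fin l → V}
    {w : ∀ i, T.Walk (u i) (v i)} (hw : ∀ i, IsTooth T (w i) ∧ (w i).length = k)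
    (hdisj : ∀ i j, i ≠ j → (w i).support.Disjoint (w j).support) {t b : V} (ht : t ≠ r)
    (htb : IsAncestor p t b) (hD : (descendants p t).card + 2 ≤ D + (descendants p b).card)
    {I : Finset (Fin l)}
    (hI : ∀ i ∈ I, ∀ x ∈ (w i).support, IsAncestor p t x ∧ ¬ IsAncestor p b x) :
    HasSplit T D k I.card := by
  have hbr : b ≠ r := fun h => ht (hR.eq_root (h ▸ htb))
  have htp : ¬ IsAncestor p t (p t) := hR.not_isAncestor_parent ht
  have hsub : descendants p b ⊆ descendants p t := fun x hx =>
    mem_descendants.2 (htb.trans (mem_descendants.1 hx))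
  have hmem : ∀ x, x ∈ insert (p t) (insert b (descendants p t \ descendants p b)) ↔
      x = p t ∨ x = b ∨ (IsAncestor p t x ∧ ¬ IsAncestor p b x) := by
    intro x
    simp
  refine ⟨insert (p t) (insert b (descendants p t \ descendants p b)),
    Finset.univ \ descendants p t, descendants p b, ?_, ?_, ?_, ?_, ?_, ?_, ?_, ?_, ?_⟩
  · refine hR.isSubtree (x := p t) (Finset.mem_insert_self _ _) fun x hx hxp => ?_
    have hx' : IsAncestor p t x ∧ (x = b ∨ ¬ IsAncestor p b x) := by
      rcases (hmem x).1 hx with h | h | h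
      · exact absurd h hxp
      · exact ⟨h ▸ htb, Or.inl h⟩
      · exact ⟨h.1, Or.inr h.2⟩
    refine ⟨fun h => ht (hR.eq_root (h ▸ hx'.1)), (hmem _).2 ?_⟩
    rcases hx'.1.eq_or_parent with h | h
    · exact Or.inl (by rw [h])
    · refine Or.inr (Or.inr ⟨h, fun hb => ?_⟩)
      rcases hx'.2 with h' | h'
      · subst h'
        exact hR.not_isAncestor_parent hbr hb
      · exact h' (hb.trans (IsAncestor.parent x))
  · refine hR.isSubtree (x := r) ?_ fun x hx hxr => ⟨hxr, ?_⟩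
    · simpa using fun h => ht (hR.eq_root h)
    · simp only [Finset.mem_sdiff, Finset.mem_univ, true_and, mem_descendants] at hx ⊢
      exact fun h => hx (h.trans (IsAncestor.parent x))
  · refine hR.isSubtree (x := b) (mem_descendants.2 (IsAncestor.refl b)) fun x hx hxb => ?_
    rw [mem_descendants] at hx ⊢
    refine ⟨fun h => hbr (hR.eq_root (h ▸ hx)), ?_⟩
    exact hx.eq_or_parent.resolve_left (Ne.symm hxb)
  · ext x
    simp only [Finset.mem_union, hmem, Finset.mem_sdiff, Finset.mem_univ, mem_descendants]
    tauto
  · have h₁ := Finset.card_insert_le (p t) (insert b (descendants p t \ descendants p b))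
    have h₂ := Finset.card_insert_le b (descendants p t \ descendants p b)
    have h₃ := Finset.card_sdiff_add_card_eq_card hsub
    omega
  · refine hasDisjTeethIn_card hw hdisj fun i hi x hx => ?_
    obtain ⟨h₁, h₂⟩ := hI i hi x hx
    refine ⟨(hmem x).2 (Or.inr (Or.inr ⟨h₁, h₂⟩)), fun y hxy => (hmem y).2 ?_⟩
    rcases hR.isAncestor_of_adj hxy h₁ with h | h
    · by_cases hb : IsAncestor p b y
      · rcases hR.isAncestor_of_adj hxy.symm hb with h' | h'
        · exact absurd h' h₂
        · exact Or.inr (Or.inl h'.1)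
      · exact Or.inr (Or.inr ⟨h, hb⟩)
    · exact Or.inl h.2
  · exact Finset.disjoint_left.2 fun x hx hx' => (Finset.mem_sdiff.1 hx).2 (hsub hx')
  · rw [Finset.card_eq_one]
    refine ⟨p t, ?_⟩
    ext x
    simp only [Finset.mem_inter, hmem, Finset.mem_sdiff, Finset.mem_univ, mem_descendants,
      Finset.mem_singleton, true_and]
    constructor
    · rintro ⟨h, h' | rfl | h'⟩
      · exact h'
      · exact absurd htb h
      · exact absurd h'.1 h
    · rintro rfl
      exact ⟨htp, Or.inl rfl⟩
  · rw [Finset.card_eq_one]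
    refine ⟨b, ?_⟩
    ext x
    simp only [Finset.mem_inter, hmem, mem_descendants, Finset.mem_singleton]
    constructor
    · rintro ⟨h, rfl | rfl | h'⟩
      · exact absurd (htb.trans h) htp
      · rfl
      · exact absurd h h'.2
    · rintro rfl
      exact ⟨IsAncestor.refl _, Or.inr (Or.inl rfl)⟩

/-- The split along the subtrees hanging below a set `C` of children of `b`. -/
theorem hasSplit_below (hR : IsRooting T r p d) {l k D : ℕ} {u v : Fin l → V}
    {w : ∀ i, T.Walk (u i) (v i)} (hw : ∀ i, IsTooth T (w i) ∧ (w i).length = k)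
    (hdisj : ∀ i j, i ≠ j → (w i).support.Disjoint (w j).support) {b : V} {C : Finset V}
    (hCne : C.Nonempty) (hC : ∀ c ∈ C, p c = b ∧ c ≠ b)
    (hD : ∑ c ∈ C, (descendants p c).card + 1 ≤ D) {I : Finset (Fin l)}
    (hI : ∀ i ∈ I, ∃ c ∈ C, ∀ x ∈ (w i).support, IsAncestor p c x) :
    HasSplit T D k I.card := by
  obtain ⟨y, hy⟩ := hCne
  have hA : ∀ x, x ∈ C.biUnion (descendants p) ↔ ∃ c ∈ C, IsAncestor p c x := by
    intro x
    simp
  have hbA : b ∉ C.biUnion (descendants p) := by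
    rw [hA]
    rintro ⟨c, hc, hcb⟩
    have h₁ := hR.depth_le hcb
    have h₂ := hR.depth_child (hC c hc).1 (hC c hc).2
    omega
  have hrA : r ∉ C.biUnion (descendants p) := by
    rw [hA]
    rintro ⟨c, hc, hcr⟩
    exact hR.ne_root_of_child (hC c hc).1 (hC c hc).2 (hR.eq_root hcr)
  have hyA : y ∈ C.biUnion (descendants p) := (hA y).2 ⟨y, hy, IsAncestor.refl y⟩
  refine ⟨insert b (C.biUnion (descendants p)), Finset.univ \ C.biUnion (descendants p), {y},
    ?_, ?_, ?_, ?_, ?_, ?_, ?_, ?_, ?_⟩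
  · refine hR.isSubtree (x := b) (Finset.mem_insert_self _ _) fun x hx hxb => ?_
    have hx := Finset.mem_of_mem_insert_of_ne hx hxb
    refine ⟨fun h => hrA (h ▸ hx), ?_⟩
    obtain ⟨c, hc, hcx⟩ := (hA x).1 hx
    rcases hcx.eq_or_parent with rfl | h
    · rw [(hC c hc).1]
      exact Finset.mem_insert_self _ _
    · exact Finset.mem_insert_of_mem ((hA _).2 ⟨c, hc, h⟩)
  · refine hR.isSubtree (x := r) (Finset.mem_sdiff.2 ⟨Finset.mem_univ _, hrA⟩)
      fun x hx hxr => ⟨hxr, Finset.mem_sdiff.2 ⟨Finset.mem_univ _, fun h => ?_⟩⟩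
    obtain ⟨c, hc, hcx⟩ := (hA _).1 h
    exact (Finset.mem_sdiff.1 hx).2 ((hA _).2 ⟨c, hc, hcx.trans (IsAncestor.parent x)⟩)
  · exact hR.isSubtree (Finset.mem_singleton_self y) fun x hx hxy =>
      absurd (Finset.mem_singleton.1 hx) hxy
  · ext x
    simp only [Finset.mem_union, Finset.mem_insert, Finset.mem_sdiff, Finset.mem_univ]
    tauto
  · have h₁ := Finset.card_insert_le b (C.biUnion (descendants p))
    have h₂ : (C.biUnion (descendants p)).card ≤ ∑ c ∈ C, (descendants p c).card :=
      Finset.card_biUnion_le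
    omega
  · refine hasDisjTeethIn_card hw hdisj fun i hi x hx => ?_
    obtain ⟨c, hc, hcx⟩ := hI i hi
    refine ⟨Finset.mem_insert_of_mem ((hA x).2 ⟨c, hc, hcx x hx⟩), fun z hxz => ?_⟩
    rcases hR.isAncestor_of_adj hxz (hcx x hx) with h | h
    · exact Finset.mem_insert_of_mem ((hA z).2 ⟨c, hc, h⟩)
    · rw [h.2, (hC c hc).1]
      exact Finset.mem_insert_self _ _
  · exact Finset.disjoint_singleton_right.2 fun h => (Finset.mem_sdiff.1 h).2 hyA
  · rw [Finset.card_eq_one]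
    refine ⟨b, ?_⟩
    ext x
    simp only [Finset.mem_inter, Finset.mem_insert, Finset.mem_sdiff, Finset.mem_univ,
      Finset.mem_singleton, true_and]
    constructor
    · rintro ⟨h, h' | h'⟩
      · exact h'
      · exact absurd h' h
    · rintro rfl
      exact ⟨hbA, Or.inl rfl⟩
  · rw [Finset.singleton_inter_of_mem (Finset.mem_insert_of_mem hyA), Finset.card_singleton]

/-- Subtrees hanging below pairwise incomparable vertices have at most `card V` vertices in
total. -/
theorem sum_card_descendants_le {C : Finset V}
    (hC : ∀ c ∈ C, ∀ c' ∈ C, IsAncestor p c c' → c = c') :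
    ∑ c ∈ C, (descendants p c).card ≤ Fintype.card V := by
  rw [← Finset.card_biUnion]
  · exact Finset.card_le_univ _
  · intro c hc c' hc' hne
    refine Finset.disjoint_left.2 fun x hx hx' => ?_
    rcases (mem_descendants.1 hx).total (mem_descendants.1 hx') with h | h
    · exact hne (hC c hc c' hc' h)
    · exact hne (hC c' hc' c hc h).symm

end IsRooting
/-- The number of descendants of `v`, rounded down in units of `a`. -/
noncomputable def weight {V : Type*} [Fintype V] (p : V → V) (a : ℕ) (v : V) : ℕ :=
  (descendants p v).card / a

open Classical in
/-- The vertices of positive weight all of whose children have smaller weight. -/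
noncomputable def peaks {V : Type*} [Fintype V] (p : V → V) (a : ℕ) : Finset V :=
  Finset.univ.filter fun v =>
    1 ≤ weight p a v ∧ ∀ c, p c = v → c ≠ v → weight p a c < weight p a v

theorem mem_peaks {V : Type*} [Fintype V] {p : V → V} {a : ℕ} {v : V} :
    v ∈ peaks p a ↔
      1 ≤ weight p a v ∧ ∀ c, p c = v → c ≠ v → weight p a c < weight p a v := by
  simp [peaks]

theorem weight_le_weight {V : Type*} [Fintype V] {p : V → V} {a : ℕ} {v w : V}
    (h : IsAncestor p v w) : weight p a w ≤ weight p a v :=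
  Nat.div_le_div_right (Finset.card_le_card fun _ hx =>
    mem_descendants.2 (h.trans (mem_descendants.1 hx)))

theorem card_descendants_lt {V : Type*} [Fintype V] {p : V → V} {a : ℕ} (ha : 0 < a) {v w : V}
    (h : weight p a v ≤ weight p a w) :
    (descendants p v).card < (descendants p w).card + a := by
  have h₁ := Nat.div_add_mod (descendants p v).card a
  have h₂ := Nat.mod_lt (descendants p v).card ha
  have h₃ := Nat.div_mul_le_self (descendants p w).card a
  have h₄ := Nat.mul_le_mul_right a h
  unfold weight at h₄
  rw [mul_comm] at h₁
  omega

theorem weight_le {V : Type*} [Fintype V] {p : V → V} {a K : ℕ}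
    (hK : Fintype.card V ≤ K * a) (v : V) : weight p a v ≤ K :=
  Nat.div_le_of_le_mul (((Finset.card_le_univ _).trans hK).trans_eq (mul_comm K a))

namespace IsRooting

variable {V : Type*} [Fintype V] [DecidableEq V] {T : SimpleGraph V} {r : V} {p : V → V}
  {d : V → ℕ}

theorem card_peaks_le {a K : ℕ} (ha : 0 < a)
    (hK : Fintype.card V ≤ K * a) : (peaks p a).card ≤ K * (K + 1) := by
  have h := Finset.card_le_mul_card_image_of_maps_to (s := peaks p a) (f := weight p a)
    (t := Finset.range (K + 1))
    (fun v _ => Finset.mem_range.2 (Nat.lt_succ_of_le (weight_le hK v))) K ?_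
  · simpa using h
  · intro j _
    have hsum := sum_card_descendants_le (p := p) (C := {v ∈ peaks p a | weight p a v = j}) ?_
    · have hge : ∀ v ∈ ({v ∈ peaks p a | weight p a v = j} : Finset V),
          a ≤ (descendants p v).card := by
        intro v hv
        have hv := (mem_peaks.1 (Finset.mem_filter.1 hv).1).1
        exact ((Nat.one_le_div_iff ha).1 hv)
      have hmul := Finset.card_nsmul_le_sum _ _ _ hge
      rw [smul_eq_mul] at hmul
      exact Nat.le_of_mul_le_mul_right ((hmul.trans hsum).trans hK) ha
    · intro b hb b' hb' hbb'
      by_contra hne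
      obtain ⟨hb, hbj⟩ := Finset.mem_filter.1 hb
      obtain ⟨_, hbj'⟩ := Finset.mem_filter.1 hb'
      obtain ⟨c, hc, hcb, hcb'⟩ := hbb'.exists_child hne
      have h₁ := (mem_peaks.1 hb).2 c hc hcb
      have h₂ := weight_le_weight (a := a) hcb'
      omega

/-- A walk avoiding the root and all peaks either lies between a vertex and a peak of the same
weight, or lies in a subtree of weight zero hanging below the root or a peak. -/
theorem walk_cases (hR : IsRooting T r p d) {a : ℕ} (hr : 1 ≤ weight p a r) {u v : V}
    (w : T.Walk u v) (hw : ∀ x ∈ w.support, x ∉ insert r (peaks p a)) :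
    ∃ b ∈ insert r (peaks p a),
      (∃ t, t ≠ r ∧ IsAncestor p t b ∧ weight p a t = weight p a b ∧
        ∀ x ∈ w.support, IsAncestor p t x ∧ ¬ IsAncestor p b x) ∨
      ∃ c, (p c = b ∧ c ≠ b ∧ weight p a c = 0) ∧ ∀ x ∈ w.support, IsAncestor p c x := by
  classical
  obtain ⟨z, hz, hzmin⟩ := Finset.exists_min_image w.support.toFinset d
    ⟨u, List.mem_toFinset.2 w.start_mem_support⟩
  rw [List.mem_toFinset] at hz
  have hzr : z ≠ r := fun h => hw z hz (h ▸ Finset.mem_insert_self _ _)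
  have hzpar : p z ∉ w.support := by
    intro h
    have h₁ := hzmin (p z) (List.mem_toFinset.2 h)
    have h₂ := hR.depth_eq z hzr
    omega
  have hzall := hR.isAncestor_of_mem_support w (fun h => hzpar h.2) hz (IsAncestor.refl z)
  obtain ⟨h, hh, hhmax⟩ := Finset.exists_max_image
    (Finset.univ.filter fun x => IsAncestor p x z ∧ 1 ≤ weight p a x) d
    ⟨r, by simp [hR.isAncestor_root, hr]⟩
  simp only [Finset.mem_filter, Finset.mem_univ, true_and] at hh hhmax
  by_cases hhB : h ∈ insert r (peaks p a)
  · refine ⟨h, hhB, Or.inr ?_⟩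
    obtain ⟨c, hc, hch, hcz⟩ := hh.1.exists_child fun heq => hw z hz (heq ▸ hhB)
    refine ⟨c, ⟨hc, hch, ?_⟩, fun x hx => hcz.trans (hzall x hx)⟩
    by_contra hpos
    have h₁ := hhmax c ⟨hcz, Nat.one_le_iff_ne_zero.2 hpos⟩
    have h₂ := hR.depth_child hc hch
    omega
  · rw [Finset.mem_insert, not_or] at hhB
    obtain ⟨b, hb, hbmax⟩ := Finset.exists_max_image
      (Finset.univ.filter fun x => IsAncestor p h x ∧ weight p a x = weight p a h) d
      ⟨h, by simp [IsAncestor.refl]⟩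
    simp only [Finset.mem_filter, Finset.mem_univ, true_and] at hb hbmax
    have hbB : b ∈ insert r (peaks p a) := by
      refine Finset.mem_insert_of_mem (mem_peaks.2 ⟨hb.2 ▸ hh.2, fun c hc hcb => ?_⟩)
      have hbc : IsAncestor p b c := hc ▸ IsAncestor.parent c
      refine lt_of_le_of_ne (weight_le_weight hbc) fun heq => ?_
      have h₁ := hbmax c ⟨hb.1.trans hbc, heq.trans hb.2⟩
      have h₂ := hR.depth_child hc hcb
      omega
    refine ⟨b, hbB, Or.inl ⟨h, hhB.1, hb.1, hb.2.symm, fun x hx =>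
      ⟨hh.1.trans (hzall x hx), fun hbx => ?_⟩⟩⟩
    have hbz := hR.isAncestor_of_mem_support w (fun h => hw b h.1 hbB) hx hbx z hz
    have hbh : h = b := by
      by_contra hne
      exact absurd (hR.depth_lt hb.1 hne) (not_lt.2 (hhmax b ⟨hbz, hb.2 ▸ hh.2⟩))
    rw [← hbh, Finset.mem_insert] at hbB
    exact hbB.elim hhB.1 hhB.2

theorem exists_hasSplit [Nontrivial V] (hR : IsRooting T r p d) {a K l k : ℕ} (ha : 0 < a)
    (haV : a ≤ Fintype.card V) (hK : Fintype.card V ≤ K * a) (hT : HasDisjTeeth T k l) :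
    ∃ m, HasSplit T (2 * a + 2) k m ∧ l ≤ (K * (K + 1) + 1) * (K + 3) * (m + 1) := by
  classical
  obtain ⟨u, v, w, hw, hdisj⟩ := hT
  have hroot : descendants p r = Finset.univ := by
    ext x
    simp [hR.isAncestor_root]
  have hr : 1 ≤ weight p a r := by
    rw [weight, hroot, Finset.card_univ]
    exact (Nat.one_le_div_iff ha).2 haV
  have hempty : HasSplit T (2 * a + 2) k (∅ : Finset (Fin l)).card := by
    obtain ⟨t, ht⟩ := exists_ne r
    exact hR.hasSplit_between hw hdisj ht (IsAncestor.refl t) (by omega) (by simp)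
  set B := insert r (peaks p a) with hB
  have hBcard : B.card ≤ K * (K + 1) + 1 :=
    (Finset.card_insert_le _ _).trans (Nat.succ_le_succ (card_peaks_le ha hK))
  let light : V → Finset V := fun b =>
    Finset.univ.filter fun c => p c = b ∧ c ≠ b ∧ weight p a c = 0
  have hlight : ∀ b c, c ∈ light b ↔ p c = b ∧ c ≠ b ∧ weight p a c = 0 := fun b c => by
    simp [light]
  have hcol : ∀ b, ∃ f : V → Fin (K + 1), ∀ κ,
      ∑ c ∈ light b with f c = κ, (descendants p c).card ≤ 2 * a := by
    intro b
    refine exists_balanced_coloring (light b) _ a K (fun c hc => ?_)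
      ((sum_card_descendants_le fun c hc c' hc' hcc' => ?_).trans hK)
    · have h := ((hlight b c).1 hc).2.2
      rw [weight, Nat.div_eq_zero_iff] at h
      omega
    · by_contra hne
      have h₁ := hR.depth_lt hcc' hne
      have h₂ := hR.depth_child ((hlight b c).1 hc).1 ((hlight b c).1 hc).2.1
      have h₃ := hR.depth_child ((hlight b c').1 hc').1 ((hlight b c').1 hc').2.1
      omega
  choose f hf using hcol
  let P : V × Option (Fin (K + 1)) → Fin l → Prop := fun x i =>
    match x.2 with
    | none => ∃ t, t ≠ r ∧ IsAncestor p t x.1 ∧ weight p a t = weight p a x.1 ∧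
        ∀ y ∈ (w i).support, IsAncestor p t y ∧ ¬ IsAncestor p x.1 y
    | some κ => ∃ c, (c ∈ light x.1 ∧ f x.1 c = κ) ∧ ∀ y ∈ (w i).support, IsAncestor p c y
  have hsplit : ∀ x (I : Finset (Fin l)), (∀ i ∈ I, P x i) →
      HasSplit T (2 * a + 2) k I.card := by
    rintro ⟨b, κ⟩ I hI
    rcases I.eq_empty_or_nonempty with rfl | ⟨i₀, hi₀⟩
    · exact hempty
    cases κ with
    | none =>
      obtain ⟨t₀, ht₀⟩ := hI i₀ hi₀
      obtain ⟨t, ht, htmin⟩ := Finset.exists_min_image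
        (Finset.univ.filter fun t => t ≠ r ∧ IsAncestor p t b ∧ weight p a t = weight p a b) d
        ⟨t₀, by simpa using ⟨ht₀.1, ht₀.2.1, ht₀.2.2.1⟩⟩
      simp only [Finset.mem_filter, Finset.mem_univ, true_and] at ht htmin
      have hcard := card_descendants_lt ha ht.2.2.le
      refine hR.hasSplit_between hw hdisj ht.1 ht.2.1 (by omega) fun i hi y hy => ?_
      obtain ⟨t', h₁, h₂, h₃, h₄⟩ := hI i hi
      refine ⟨IsAncestor.trans ?_ (h₄ y hy).1, (h₄ y hy).2⟩
      rcases ht.2.1.total h₂ with h | h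
      · exact h
      · by_cases heq : t' = t
        · exact heq ▸ IsAncestor.refl _
        · exact absurd (hR.depth_lt h heq) (not_lt.2 (htmin t' ⟨h₁, h₂, h₃⟩))
    | some κ =>
      obtain ⟨c₀, hc₀, -⟩ := hI i₀ hi₀
      refine hR.hasSplit_below hw hdisj (b := b) (C := {c ∈ light b | f b c = κ})
        ⟨c₀, Finset.mem_filter.2 hc₀⟩ (fun c hc => ?_) ?_ fun i hi => ?_
      · have h := (hlight b c).1 (Finset.mem_filter.1 hc).1
        exact ⟨h.1, h.2.1⟩
      · have := hf b κ
        omega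
      · obtain ⟨c, hc, h⟩ := hI i hi
        exact ⟨c, Finset.mem_filter.2 hc, h⟩
  let G : Finset (Fin l) := Finset.univ.filter fun i => ∀ x ∈ (w i).support, x ∉ B
  have hG : ∀ i, i ∈ G ↔ ∀ x ∈ (w i).support, x ∉ B := fun i => by simp [G]
  have hGc : Gᶜ.card ≤ B.card := by
    have hex : ∀ i : Fin l, ∃ x, i ∈ Gᶜ → x ∈ (w i).support ∧ x ∈ B := by
      intro i
      by_cases hi : i ∈ Gᶜ
      · rw [Finset.mem_compl, hG] at hi
        push Not at hi
        obtain ⟨x, hx⟩ := hi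
        exact ⟨x, fun _ => hx⟩
      · exact ⟨r, fun h => absurd h hi⟩
    choose g hg using hex
    refine Finset.card_le_card_of_injOn g (fun i hi => (hg i hi).2) fun i hi j hj hij => ?_
    by_contra hne
    exact hdisj i j hne (hg i hi).1 (hij ▸ (hg j hj).1)
  have hlab : ∀ i : Fin l, ∃ x, i ∈ G → x ∈ B ×ˢ Finset.univ ∧ P x i := by
    intro i
    by_cases hi : i ∈ G
    · obtain ⟨b, hb, ⟨t, ht⟩ | ⟨c, hc, h⟩⟩ := hR.walk_cases hr (w i) ((hG i).1 hi)
      · exact ⟨(b, none), fun _ => ⟨Finset.mem_product.2 ⟨hb, Finset.mem_univ _⟩, t, ht⟩⟩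
      · exact ⟨(b, some (f b c)), fun _ =>
          ⟨Finset.mem_product.2 ⟨hb, Finset.mem_univ _⟩, c, ⟨(hlight b c).2 hc, rfl⟩, h⟩⟩
    · exact ⟨(r, none), fun h => absurd h hi⟩
  choose lab hlab using hlab
  obtain ⟨x₀, -, hmax⟩ := Finset.exists_max_image
    (B ×ˢ (Finset.univ : Finset (Option (Fin (K + 1))))) (fun x => {i ∈ G | lab i = x}.card)
    ⟨(r, none), by simp [hB]⟩
  have hpig := Finset.card_le_mul_card_image_of_maps_to (fun i hi => (hlab i hi).1) _ hmax
  refine ⟨{i ∈ G | lab i = x₀}.card, hsplit x₀ _ fun i hi => ?_, ?_⟩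
  · obtain ⟨hiG, hix⟩ := Finset.mem_filter.1 hi
    exact hix ▸ (hlab i hiG).2
  · have hl : G.card + Gᶜ.card = l := by simp [Finset.card_add_card_compl]
    rw [Finset.card_product, Finset.card_univ, Fintype.card_option, Fintype.card_fin] at hpig
    generalize {i ∈ G | lab i = x₀}.card = m at hpig ⊢
    calc l ≤ m * (B.card * (K + 1 + 1)) + B.card := by omega
      _ ≤ m * ((K * (K + 1) + 1) * (K + 1 + 1)) + (K * (K + 1) + 1) := by gcongr
      _ ≤ _ := by nlinarith [Nat.zero_le ((K * (K + 1) + 1) * (K + 2)),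
                    Nat.zero_le ((K * (K + 1) + 1) * m)]

end IsRooting

/-- For any `ε > 0` there are `β > 0` and `n₀` such that: every tree `T` on `n ≥ n₀`
vertices with `l` vertex-disjoint teeth of length `k` admits subtrees `S, T₁, T₂`
covering `T` with `|S| ≤ εn`, `S` having at least `βl - 1` vertex-disjoint teeth of
length `k` which are also teeth of `T`, and `T₁, T₂` disjoint, each meeting `S` in
exactly one vertex. -/
theorem stmt11 (ε : ℝ) (hε : 0 < ε) :
    ∃ (β : ℝ) (n₀ : ℕ), 0 < β ∧
      ∀ l k n : ℕ, n₀ ≤ n → ∀ T : SimpleGraph (Fin n), T.IsTree →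
        HasDisjTeeth T k l →
        ∃ S T₁ T₂ : Finset (Fin n),
          IsSubtree T S ∧ IsSubtree T T₁ ∧ IsSubtree T T₂ ∧
          S ∪ T₁ ∪ T₂ = Finset.univ ∧
          (S.card : ℝ) ≤ ε * n ∧
          (∃ m : ℕ, β * l - 1 ≤ m ∧ HasDisjTeethIn T S k m) ∧
          Disjoint T₁ T₂ ∧ (T₁ ∩ S).card = 1 ∧ (T₂ ∩ S).card = 1 := by
  obtain ⟨K, hK⟩ := exists_nat_ge (4 / ε)
  obtain ⟨N, hN⟩ := exists_nat_ge (8 / ε)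
  set c : ℝ := ((((K + 2) * (K + 3) + 1) * (K + 5) : ℕ) : ℝ) with hc
  have hcpos : 0 < c := by positivity
  refine ⟨1 / c, N + 2, by positivity, fun l k n hn T hT hteeth => ?_⟩
  have : Nontrivial (Fin n) := Fin.nontrivial_iff_two_le.2 (by omega)
  obtain ⟨p, d, hR⟩ := hT.exists_isRooting (⟨0, by omega⟩ : Fin n)
  have hle : n / (K + 2) + 1 ≤ n := Nat.div_lt_self (by omega) (by omega)
  have hmul : n ≤ (K + 2) * (n / (K + 2) + 1) := (Nat.lt_mul_div_succ n (by omega)).le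
  obtain ⟨m, ⟨S, T₁, T₂, hS, h₁, h₂, hcov, hcard, hm, hdisj, hi₁, hi₂⟩, hl⟩ :=
    hR.exists_hasSplit (K := K + 2) (Nat.succ_pos (n / (K + 2))) (by simpa using hle)
      (by simpa using hmul) hteeth
  refine ⟨S, T₁, T₂, hS, h₁, h₂, hcov, ?_, ⟨m, ?_, hm⟩, hdisj, hi₁, hi₂⟩
  · have hdiv : ((n / (K + 2) : ℕ) : ℝ) * (K + 2) ≤ n := by
      exact_mod_cast Nat.div_mul_le_self n (K + 2)
    have hcard' : (S.card : ℝ) ≤ 2 * ((n / (K + 2) : ℕ) : ℝ) + 4 := by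
      have : S.card ≤ 2 * (n / (K + 2)) + 4 := by omega
      exact_mod_cast this
    have hn' : (N : ℝ) + 2 ≤ n := by exact_mod_cast hn
    rw [div_le_iff₀ hε] at hK hN
    have hx : (0 : ℝ) ≤ ((n / (K + 2) : ℕ) : ℝ) := Nat.cast_nonneg _
    have e₁ : 4 * ((n / (K + 2) : ℕ) : ℝ) ≤ n * ε := by nlinarith
    have e₂ : 8 ≤ n * ε := by nlinarith
    linarith
  · have hl' : (l : ℝ) ≤ c * (m + 1) := by
      rw [hc]
      exact_mod_cast hl
    rw [one_div, inv_mul_eq_div, sub_le_iff_le_add, div_le_iff₀ hcpos]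
    linarith
end

section
/- For every tree S there exist two subtrees S₁ and S₂ which divide S and satisfy |S₁| ≥ |S|/3 and |S₂| ≥ |S|/3. -/
namespace SimpleGraph

variable {V : Type*} {G : SimpleGraph V}

/-- `W` is nonempty and no nonempty proper subset of `W` is closed under adjacency within `W`. -/
def Uncut (G : SimpleGraph V) (W : Finset V) : Prop :=
  W.Nonempty ∧ ∀ U ⊆ W, U.Nonempty → (∀ x ∈ U, ∀ y ∈ W, G.Adj x y → y ∈ U) → U = W

theorem Uncut.induce_connected {W : Finset V} (h : G.Uncut W) :
    (G.induce (↑W : Set V)).Connected := by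
  classical
  obtain ⟨⟨r, hr⟩, hcut⟩ := h
  let root : (↑W : Set V) := ⟨r, hr⟩
  have hU := hcut (W.filter fun x => ∃ hx : x ∈ (↑W : Set V),
      (G.induce (↑W : Set V)).Reachable root ⟨x, hx⟩) (Finset.filter_subset _ _)
    ⟨r, Finset.mem_filter.2 ⟨hr, hr, Reachable.refl _⟩⟩ (by
      intro x hx y hy hxy
      obtain ⟨hxW, hx', hreach⟩ := Finset.mem_filter.1 hx
      refine Finset.mem_filter.2 ⟨hy, hy, hreach.trans (Adj.reachable ?_)⟩
      exact hxy)
  have hroot (x : (↑W : Set V)) : (G.induce (↑W : Set V)).Reachable root x := by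
    exact (Finset.mem_filter.1 (hU.ge x.2)).2.2
  exact (connected_iff_exists_forall_reachable _).2 ⟨root, hroot⟩

theorem Connected.uncut_univ [Fintype V] (h : G.Connected) : G.Uncut Finset.univ := by
  have := h.nonempty
  refine ⟨Finset.univ_nonempty, fun U _ ⟨r, hr⟩ hcl => Finset.eq_univ_of_forall fun x => ?_⟩
  obtain ⟨p⟩ := h.preconnected r x
  induction p with
  | nil => exact hr
  | cons hadj _ ih => exact ih (hcl _ hr _ (Finset.mem_univ _) hadj)

theorem uncut_singleton (v : V) : G.Uncut {v} :=
  ⟨Finset.singleton_nonempty v, fun _ hU hne _ => hne.subset_singleton_iff.1 hU⟩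

variable [DecidableEq V]

theorem Uncut.subset_of_closed {A W U : Finset V} (h : G.Uncut A) (hAW : A ⊆ W)
    (hcl : ∀ x ∈ U, ∀ y ∈ W, G.Adj x y → y ∈ U) {a : V} (haA : a ∈ A) (haU : a ∈ U) :
    A ⊆ U := by
  have := h.2 (U ∩ A) Finset.inter_subset_right ⟨a, by simp [*]⟩ (by grind)
  exact Finset.inter_eq_right.1 this

theorem Uncut.union {A B : Finset V} (hA : G.Uncut A) (hB : G.Uncut B) {a b : V}
    (ha : a ∈ A) (hb : b ∈ B) (hab : a = b ∨ G.Adj a b) : G.Uncut (A ∪ B) := by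
  refine ⟨⟨a, by simp [ha]⟩, fun U hU ⟨x, hx⟩ hcl => hU.antisymm ?_⟩
  have hA' := fun c => hA.subset_of_closed (a := c) Finset.subset_union_left hcl
  have hB' := fun c => hB.subset_of_closed (a := c) Finset.subset_union_right hcl
  have hiff : a ∈ U ↔ b ∈ U := by
    rcases hab with rfl | hab
    · rfl
    · exact ⟨fun h => hcl _ h _ (Finset.mem_union_right _ hb) hab,
        fun h => hcl _ h _ (Finset.mem_union_left _ ha) hab.symm⟩
  have haU : a ∈ U := by
    rcases Finset.mem_union.1 (hU hx) with h | h
    · exact hA' x h hx ha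
    · exact hiff.2 (hB' x h hx hb)
  exact Finset.union_subset (hA' a ha haU) (hB' b hb (hiff.1 haU))

theorem Uncut.left_of_separation {B C D : Finset V} {v : V} (hB : G.Uncut B)
    (hCD : C ∪ D = B) (hv : C ∩ D = {v})
    (hsep : ∀ x ∈ C, ∀ y ∈ D, G.Adj x y → x = v ∨ y = v) : G.Uncut C := by
  have hvCD : v ∈ C ∩ D := by simp [hv]
  obtain ⟨hvC, hvD⟩ := Finset.mem_inter.1 hvCD
  have hvC' : ∀ x ∈ C, x ∈ D → x = v := fun x hx hx' => by
    simpa [hv] using Finset.mem_inter.2 ⟨hx, hx'⟩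
  refine ⟨⟨v, hvC⟩, fun U hU hne hcl => ?_⟩
  by_cases hvU : v ∈ U
  · have := hB.2 (U ∪ D) (by grind) ⟨v, by simp [hvU]⟩ (by
      intro x hx y hy hxy
      have := hxy.symm
      grind)
    refine hU.antisymm fun x hx => ?_
    have hxB : x ∈ U ∪ D := this ▸ hCD ▸ Finset.mem_union_left D hx
    grind
  · have := hB.2 U (by grind) hne (by grind)
    grind

theorem Uncut.exists_separation {B : Finset V} {v : V} (hB : G.Uncut B) (hv : v ∈ B)
    (hne : (B.erase v).Nonempty) (hcut : ¬ G.Uncut (B.erase v)) :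
    ∃ C D, G.Uncut C ∧ G.Uncut D ∧ C ∪ D = B ∧ C ∩ D = {v} ∧ 2 ≤ C.card ∧ 2 ≤ D.card := by
  simp only [Uncut, hne, true_and] at hcut
  push Not at hcut
  obtain ⟨U, hU, hUne, hcl, hUB⟩ := hcut
  have hvU : v ∉ U := fun h => Finset.notMem_erase v B (hU h)
  have h₁ : insert v U ∪ B \ U = B := by grind
  have h₂ : insert v U ∩ (B \ U) = {v} := by grind
  have hsep : ∀ x ∈ insert v U, ∀ y ∈ B \ U, G.Adj x y → x = v ∨ y = v := by grind
  refine ⟨insert v U, B \ U, hB.left_of_separation h₁ h₂ hsep,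
    hB.left_of_separation (by rw [Finset.union_comm, h₁]) (by rw [Finset.inter_comm, h₂])
      (fun x hx y hy hxy => (hsep y hy x hx hxy.symm).symm), h₁, h₂, ?_, ?_⟩
  · rw [Finset.card_insert_of_notMem hvU]
    have := hUne.card_pos
    omega
  · obtain ⟨w, hw, hwU⟩ := Finset.exists_of_ssubset (hU.ssubset_of_ne hUB)
    rw [← Finset.card_pair (Finset.ne_of_mem_erase hw)]
    exact Finset.card_le_card (by grind)

theorem Uncut.exists_adj {B : Finset V} {v : V} (hB : G.Uncut B) (hv : v ∈ B)
    (hne : (B.erase v).Nonempty) : ∃ w ∈ B, w ≠ v ∧ G.Adj v w := by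
  by_contra! h
  have := hB.2 {v} (by simpa using hv) (by simp) (by grind)
  grind

theorem Connected.exists_division [Fintype V] (h : G.Connected) {k : ℕ} (hk : 1 ≤ k)
    (hkn : 3 * k ≤ Fintype.card V + 2) :
    ∃ A B v, G.Uncut A ∧ G.Uncut B ∧ A ∪ B = Finset.univ ∧ A ∩ B = {v} ∧
      k ≤ A.card ∧ k ≤ B.card := by
  induction k, hk using Nat.le_induction with
  | base =>
    obtain ⟨v⟩ := h.nonempty
    exact ⟨{v}, Finset.univ, v, uncut_singleton v, h.uncut_univ, by simp, by simp, by simp,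
      Finset.card_pos.2 ⟨v, Finset.mem_univ v⟩⟩
  | succ k hk ih =>
    obtain ⟨A, B, v, hA, hB, hAB, hv, hkA, hkB⟩ := ih (by omega)
    wlog hle : A.card ≤ B.card generalizing A B
    · exact this B A hB hA (by rw [Finset.union_comm, hAB]) (by rw [Finset.inter_comm, hv])
        hkB hkA (by omega)
    by_cases hkA' : k + 1 ≤ A.card
    · exact ⟨A, B, v, hA, hB, hAB, hv, hkA', by omega⟩
    have hcard := Finset.card_union_add_card_inter A B
    rw [hAB, hv, Finset.card_univ, Finset.card_singleton] at hcard
    have hvAB : v ∈ A ∩ B := by simp [hv]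
    obtain ⟨hvA, hvB⟩ := Finset.mem_inter.1 hvAB
    have hvAB' : ∀ x ∈ A, x ∈ B → x = v := fun x hx hx' => by
      simpa [hv] using Finset.mem_inter.2 ⟨hx, hx'⟩
    have hcover : ∀ x, x ∈ A ∨ x ∈ B := fun x => by
      simpa [hAB] using Finset.mem_union (s := A) (t := B) (a := x)
    have herase := Finset.card_erase_of_mem hvB
    have hne : (B.erase v).Nonempty := Finset.card_pos.1 (by omega)
    by_cases hconn : G.Uncut (B.erase v)
    · obtain ⟨w, hwB, hwv, hadj⟩ := hB.exists_adj hvB hne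
      refine ⟨A ∪ {w}, B.erase v, w,
        hA.union (uncut_singleton w) hvA (Finset.mem_singleton_self w) (Or.inr hadj), hconn,
        ?_, ?_, ?_, by omega⟩
      · ext x; grind
      · ext x; grind
      · rw [Finset.card_union_of_disjoint (by grind [Finset.disjoint_singleton_right]),
          Finset.card_singleton]
        omega
    · obtain ⟨C, D, hC, hD, hCD, hCDv, hC2, hD2⟩ := hB.exists_separation hvB hne hconn
      wlog hCDle : C.card ≤ D.card generalizing C D
      · exact this D C hD hC (by rw [Finset.union_comm, hCD])
          (by rw [Finset.inter_comm, hCDv]) hD2 hC2 (by omega)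
      have hcardB := Finset.card_union_add_card_inter C D
      rw [hCD, hCDv, Finset.card_singleton] at hcardB
      have hvCD : v ∈ C ∩ D := by simp [hCDv]
      obtain ⟨hvC, hvD⟩ := Finset.mem_inter.1 hvCD
      have hAC : A ∩ C = {v} := by grind
      have hcardAC := Finset.card_union_add_card_inter A C
      rw [hAC, Finset.card_singleton] at hcardAC
      refine ⟨A ∪ C, D, v, hA.union hC hvA hvC (Or.inl rfl), hD, ?_, ?_, by omega, by omega⟩
      · rw [Finset.union_assoc, hCD, hAB]
      · rw [Finset.union_inter_distrib_right, hCDv]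
        grind

end SimpleGraph


/-- Two subtrees `S₁` and `S₂` divide the tree `S` if they cover it and their vertex sets
intersect in exactly one vertex. Every tree can be divided into two subtrees each on at
least a third of its vertices. -/
theorem stmt12 {V : Type*} [Fintype V] [DecidableEq V] [Nonempty V]
    (S : SimpleGraph V) (hS : S.IsTree) :
    ∃ S₁ S₂ : Finset V,
      IsSubtree S S₁ ∧ IsSubtree S S₂ ∧
      S₁ ∪ S₂ = Finset.univ ∧ (S₁ ∩ S₂).card = 1 ∧
      (Fintype.card V : ℝ) / 3 ≤ S₁.card ∧ (Fintype.card V : ℝ) / 3 ≤ S₂.card := by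
  obtain ⟨A, B, v, hA, hB, hAB, hv, hkA, hkB⟩ :=
    hS.connected.exists_division (k := (Fintype.card V + 2) / 3)
      (by have := Fintype.card_pos (α := V); omega) (by omega)
  refine ⟨A, B, ⟨hA.1, hA.induce_connected⟩, ⟨hB.1, hB.induce_connected⟩, hAB, by simp [hv],
    ?_, ?_⟩
  · rw [div_le_iff₀ three_pos]
    exact_mod_cast (by omega : Fintype.card V ≤ A.card * 3)
  · rw [div_le_iff₀ three_pos]
    exact_mod_cast (by omega : Fintype.card V ≤ B.card * 3)
end
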